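/- arXiv:2003.05500 — 2 statements merged into one kernel-verified Lean document; each statement's English description precedes it below -/
import Mathlib

section
/- Let X be a stationary stochastic process over a finite alphabet A with stationary measure μ on A^ℕ, and let f be the run-length encoder. If H̲₂(f_*μ) > 0, hypothesis (A) holds, and the process is ψ-mixing with ψ(g) = g^{−a} for some a > 0, then for μ⊗μ-almost every pair of sequences (x, y), liminf_{n→∞} M^RLE_n(x,y)/log n ≥ 2/H̄₂(f_*μ); consequently, if the Rényi entropy of order 2 of f_*μ exists, lim_{n→∞} M^RLE_n(x,y)/log n = 2/H₂(f_*μ) almost surely. -/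
open MeasureTheory Filter Topology

section RLEDefs

variable {A : Type*}

/-- The starting position of the run following the run that starts at position `i`:
the least index `> i` where the value of `x` changes (with the junk convention `i + 1`
if the sequence is constant from position `i` on). -/
noncomputable def nextChange (x : ℕ → A) (i : ℕ) : ℕ := by
  classical
  exact if h : ∃ j, x (i + j + 1) ≠ x i then i + Nat.find h + 1 else i + 1

/-- Starting position of the `n`-th maximal run of the sequence `x`. -/
noncomputable def runStart (x : ℕ → A) : ℕ → ℕ
  | 0 => 0
  | n + 1 => nextChange x (runStart x n)

/-- The run-length encoder `f : A^ℕ → (A × ℕ)^ℕ`: the `n`-th symbol of `f x` is the pair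
(value of the `n`-th maximal run of `x`, length of that run). -/
noncomputable def rle (x : ℕ → A) (n : ℕ) : A × ℕ :=
  (x (runStart x n), runStart x (n + 1) - runStart x n)

/-- `M_n(u,v)`: the length of the longest common substring of `u` and `v`
occurring within their first `n` symbols, i.e.
`max {k : u_i^{i+k-1} = v_j^{j+k-1} for some 0 ≤ i,j ≤ n-k}`. -/
noncomputable def matchLen {C : Type*} (u v : ℕ → C) (n : ℕ) : ℕ :=
  sSup {k | ∃ i j, i + k ≤ n ∧ j + k ≤ n ∧ ∀ m < k, u (i + m) = v (j + m)}

/-- `M^RLE_n(x,y) = M_n(f x, f y)`. -/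
noncomputable def MRLE (x y : ℕ → A) (n : ℕ) : ℕ := matchLen (rle x) (rle y) n

/-- `M̃_n(x,y) = max {k : f(σ^i x)_1^k = f(σ^j y)_1^k for some 0 ≤ i,j ≤ n-k}`. -/
noncomputable def Mtilde (x y : ℕ → A) (n : ℕ) : ℕ :=
  sSup {k | ∃ i j, i + k ≤ n ∧ j + k ≤ n ∧
    ∀ m < k, rle (fun t => x (t + i)) m = rle (fun t => y (t + j)) m}

/-- The number of maximal runs in the first `n` symbols of `x`, i.e. `|f(x_1^n)|`. -/
noncomputable def runCount (x : ℕ → A) (n : ℕ) : ℕ := by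
  classical
  exact ((Finset.range n).filter fun i => i = 0 ∨ x i ≠ x (i - 1)).card

/-- The left shift `σ` on sequences. -/
def shift (x : ℕ → A) : ℕ → A := fun n => x (n + 1)

variable [MeasurableSpace A]

/-- `Σ_{ω ∈ B^n} (f_*μ)(ω)²`: the sum, over all cylinders `ω` of length `n` in
`B^ℕ = (A × ℕ)^ℕ`, of the squared measure of `f⁻¹ω` (where `f` is the run-length
encoder), i.e. of the squared pushforward measure of the cylinder. -/
noncomputable def pushCylSum (μ : Measure (ℕ → A)) (n : ℕ) : ℝ :=
  ∑' ω : Fin n → A × ℕ, ((μ {x | ∀ i : Fin n, rle x i = ω i}).toReal) ^ 2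

/-- Lower Rényi entropy of order 2 of the pushforward measure `f_*μ`:
`H̲₂(f_*μ) = - liminf_n (1/n) log Σ_ω (f_*μ)(ω)²`. -/
noncomputable def H2lower (μ : Measure (ℕ → A)) : ℝ :=
  -liminf (fun n : ℕ => Real.log (pushCylSum μ n) / n) atTop

/-- Upper Rényi entropy of order 2 of the pushforward measure `f_*μ`:
`H̄₂(f_*μ) = - limsup_n (1/n) log Σ_ω (f_*μ)(ω)²`. -/
noncomputable def H2upper (μ : Measure (ℕ → A)) : ℝ :=
  -limsup (fun n : ℕ => Real.log (pushCylSum μ n) / n) atTop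

/-- Hypothesis (A): there are `c > 0`, `h > 0` with `μ(a…a) ≤ c e^{-hn}` for every
constant cylinder `a…a` of length `n`. -/
def HypA (μ : Measure (ℕ → A)) (c h : ℝ) : Prop :=
  0 < c ∧ 0 < h ∧
    ∀ (n : ℕ) (a : A), μ {x | ∀ i < n, x i = a} ≤ ENNReal.ofReal (c * Real.exp (-h * n))

/-- The σ-algebra `F_0^n` generated by the coordinates `X_0, …, X_n`. -/
def cylAlgLE (A : Type*) [MeasurableSpace A] (n : ℕ) : MeasurableSpace (ℕ → A) :=
  MeasurableSpace.comap (fun x (i : Fin (n + 1)) => x i) inferInstance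

/-- The σ-algebra `F_m^∞` generated by the coordinates `X_m, X_{m+1}, …`. -/
def cylAlgGE (A : Type*) [MeasurableSpace A] (m : ℕ) : MeasurableSpace (ℕ → A) :=
  MeasurableSpace.comap (fun x (i : ℕ) => x (m + i)) inferInstance

/-- α-mixing with rate function `a`: for all `n, g` and all `S ∈ F_0^n`, `T ∈ F_{n+g}^∞`,
`|μ(S ∩ T) - μ(S)μ(T)| ≤ a(g)`. -/
def AlphaMixingBound (μ : Measure (ℕ → A)) (a : ℕ → ℝ) : Prop :=
  ∀ (n g : ℕ) (S T : Set (ℕ → A)),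
    MeasurableSet[cylAlgLE A n] S → MeasurableSet[cylAlgGE A (n + g)] T →
    |(μ (S ∩ T)).toReal - (μ S).toReal * (μ T).toReal| ≤ a g

/-- α-mixing with exponential decay. -/
def AlphaMixingExp (μ : Measure (ℕ → A)) : Prop :=
  ∃ C θ : ℝ, 0 < C ∧ 0 < θ ∧ AlphaMixingBound μ fun g => C * Real.exp (-θ * g)

/-- ψ-mixing with polynomial rate `ψ(g) = g^{-a}`: for all `n` and `g ≥ 1` and all
`S ∈ F_0^n`, `T ∈ F_{n+g}^∞`, `|μ(S ∩ T) - μ(S)μ(T)| ≤ g^{-a} μ(S) μ(T)`. -/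
def PsiMixingPoly (μ : Measure (ℕ → A)) (a : ℝ) : Prop :=
  ∀ (n g : ℕ), 1 ≤ g → ∀ (S T : Set (ℕ → A)),
    MeasurableSet[cylAlgLE A n] S → MeasurableSet[cylAlgGE A (n + g)] T →
    |(μ (S ∩ T)).toReal - (μ S).toReal * (μ T).toReal| ≤
      (g : ℝ) ^ (-a) * (μ S).toReal * (μ T).toReal

/-- `S_n = Σ_{0 ≤ i,j ≤ n-1} 1_{A_{i,j}}` with `A_{i,j} = {f(σ^i X)_1^k = f(σ^j Y)_1^k}`,
seen as a random variable on the product space (X = first coordinate, Y = second). -/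
noncomputable def Sn (k n : ℕ) (p : (ℕ → A) × (ℕ → A)) : ℝ := by
  classical
  exact ∑ i ∈ Finset.range n, ∑ j ∈ Finset.range n,
    if ∀ m < k, rle (fun t => p.1 (t + i)) m = rle (fun t => p.2 (t + j)) m then (1 : ℝ) else 0

end RLEDefs


open MeasureTheory Filter Topology

section comb
variable {A : Type*}

def sh (i : ℕ) (x : ℕ → A) : ℕ → A := fun t => x (t + i)

lemma sh_sh (i j : ℕ) (x : ℕ → A) : sh i (sh j x) = sh (i + j) x := by
  funext t; simp [sh, add_assoc]

lemma nextChange_eq (x : ℕ → A) (i j : ℕ) (hij : i < j) (hne : x j ≠ x i)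
    (hc : ∀ l, i < l → l < j → x l = x i) : nextChange x i = j := by
  classical
  have hex : ∃ t, x (i + t + 1) ≠ x i := ⟨j - i - 1, by
    have : i + (j - i - 1) + 1 = j := by omega
    rw [this]; exact hne⟩
  unfold nextChange
  rw [dif_pos hex]
  have : Nat.find hex = j - i - 1 := by
    rw [Nat.find_eq_iff]
    refine ⟨?_, ?_⟩
    · have : i + (j - i - 1) + 1 = j := by omega
      rw [this]; exact hne
    · intro n hn
      simp only [ne_eq, not_not]
      exact hc _ (by omega) (by omega)
  omega

lemma nextChange_gt (x : ℕ → A) (i : ℕ) : i < nextChange x i := by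
  classical
  unfold nextChange
  split_ifs <;> omega

lemma nextChange_ne (x : ℕ → A) (i : ℕ) (hex : ∃ t, x (i + t + 1) ≠ x i) :
    x (nextChange x i) ≠ x i := by
  classical
  unfold nextChange
  rw [dif_pos hex]
  exact Nat.find_spec hex

lemma nextChange_const (x : ℕ → A) (i l : ℕ) (h1 : i ≤ l) (h2 : l < nextChange x i) :
    x l = x i := by
  classical
  rcases h1.eq_or_lt with rfl | h1
  · rfl
  by_cases hex : ∃ t, x (i + t + 1) ≠ x i
  · unfold nextChange at h2
    rw [dif_pos hex] at h2
    have := Nat.find_min hex (m := l - i - 1) (by omega)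
    simp only [ne_eq, not_not] at this
    have h3 : i + (l - i - 1) + 1 = l := by omega
    rwa [h3] at this
  · unfold nextChange at h2
    rw [dif_neg hex] at h2
    omega

lemma nextChange_le (x : ℕ → A) (i j : ℕ) (hij : i < j) (hne : x j ≠ x i) :
    nextChange x i ≤ j := by
  by_contra hlt
  exact hne (nextChange_const x i j hij.le (by omega))

lemma nextChange_sh (x : ℕ → A) (s i : ℕ) :
    nextChange (sh s x) i + s = nextChange x (i + s) := by
  classical
  have key : ∀ t, sh s x (i + t + 1) ≠ sh s x i ↔ x (i + s + t + 1) ≠ x (i + s) := by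
    intro t
    simp only [sh]
    rw [show i + t + 1 + s = i + s + t + 1 by ring]
  by_cases hex : ∃ t, x (i + s + t + 1) ≠ x (i + s)
  · symm
    have hex' : ∃ t, sh s x (i + t + 1) ≠ sh s x i := by
      obtain ⟨t, ht⟩ := hex
      exact ⟨t, (key t).2 ht⟩
    apply nextChange_eq
    · have := nextChange_gt (sh s x) i
      omega
    · exact nextChange_ne (sh s x) i hex'
    · intro l h1 h2
      have := nextChange_const (sh s x) i (l - s) (by omega) (by omega)
      simp only [sh] at this
      rwa [show l - s + s = l by omega] at this
  · have hex' : ¬ ∃ t, sh s x (i + t + 1) ≠ sh s x i := by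
      rintro ⟨t, ht⟩
      exact hex ⟨t, (key t).1 ht⟩
    unfold nextChange
    rw [dif_neg hex, dif_neg hex']
    omega

lemma runStart_sh (x : ℕ → A) (n m : ℕ) :
    runStart (sh (runStart x n) x) m + runStart x n = runStart x (n + m) := by
  induction m with
  | zero => simp [runStart]
  | succ m ih =>
    rw [show n + (m + 1) = (n + m) + 1 by ring]
    simp only [runStart]
    rw [nextChange_sh, ih]

lemma rle_sh (x : ℕ → A) (n m : ℕ) :
    rle (sh (runStart x n) x) m = rle x (n + m) := by
  unfold rle
  rw [show n + m + 1 = n + (m + 1) by ring, ← runStart_sh x n m, ← runStart_sh x n (m+1)]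
  simp only [sh]
  congr 1
  omega

lemma runStart_lt_succ (x : ℕ → A) (n : ℕ) : runStart x n < runStart x (n+1) :=
  nextChange_gt _ _

lemma runStart_strictMono (x : ℕ → A) : StrictMono (runStart x) :=
  strictMono_nat_of_lt_succ (runStart_lt_succ x)

lemma le_runStart (x : ℕ → A) (n : ℕ) : n ≤ runStart x n := (runStart_strictMono x).le_apply

lemma runStart_eq_sum (x : ℕ → A) (n : ℕ) : runStart x n = ∑ i : Fin n, (rle x i).2 := by
  rw [Fin.sum_univ_eq_sum_range (fun i => (rle x i).2)]
  induction n with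
  | zero => simp [runStart]
  | succ n ih =>
    rw [Finset.sum_range_succ, ← ih]
    simp only [rle]
    have := runStart_lt_succ x n
    omega

/-- matching from position `i` onwards, after dropping the first run, occurs inside `rle x`. -/
lemma rle_pos (x : ℕ → A) (hx : ∀ i, ∃ t, x (i + t + 1) ≠ x i) (i : ℕ) :
    ∃ r ≤ i, ∀ m, rle (sh i x) (1 + m) = rle x (r + 1 + m) := by
  classical
  have hfin : ∃ r, i < runStart x (r + 1) := ⟨i, by have := le_runStart x (i+1); omega⟩
  obtain ⟨r, hr1, hr2⟩ : ∃ r, i < runStart x (r+1) ∧ runStart x r ≤ i := by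
    refine ⟨Nat.find hfin, Nat.find_spec hfin, ?_⟩
    rcases Nat.eq_zero_or_pos (Nat.find hfin) with h0 | h0
    · rw [h0]; simp [runStart]
    · have := Nat.find_min hfin (m := Nat.find hfin - 1) (by omega)
      rw [show Nat.find hfin - 1 + 1 = Nat.find hfin by omega] at this
      omega
  refine ⟨r, (le_runStart x r).trans hr2, fun m => ?_⟩
  have hxi : x i = x (runStart x r) := nextChange_const x _ _ hr2 hr1
  have h1 : nextChange x i = runStart x (r+1) := by
    apply nextChange_eq _ _ _ hr1
    · rw [hxi]; exact nextChange_ne _ _ (hx _)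
    · intro l h1 h2
      rw [hxi]
      exact nextChange_const x _ _ (by omega) h2
  have h2 : runStart (sh i x) 1 + i = runStart x (r+1) := by
    simp only [runStart]
    rw [nextChange_sh, zero_add, h1, runStart]
  rw [← rle_sh, ← rle_sh x (r+1) m, sh_sh, h2]

lemma runStart_le (x : ℕ → A) (K l : ℕ) (hl : 0 < l) (hx : ∀ i < K * l, ∃ t < l, x (i + t) ≠ x i) :
    ∀ m ≤ K, runStart x m ≤ m * l := by
  intro m
  induction m with
  | zero => intro _; simp [runStart]
  | succ m ih =>
    intro hm
    have h1 := ih (by omega)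
    have h2 : m * l + l ≤ K * l := by
      have := Nat.mul_le_mul_right l hm
      linarith [add_one_mul m l]
    obtain ⟨t, ht, hne⟩ := hx (runStart x m) (by omega)
    have h3 := nextChange_le x (runStart x m) (runStart x m + t)
      (by rcases Nat.eq_zero_or_pos t with rfl | h
          · simp at hne
          · omega) hne
    simp only [runStart]
    rw [add_one_mul]
    omega
end comb

open MeasureTheory Filter Topology

section cyl
variable {A : Type*}

def Cyl {n : ℕ} (ω : Fin n → A × ℕ) : Set (ℕ → A) :=
  {x | (∀ i : Fin n, rle x i = ω i) ∧ ∀ m < n, x (runStart x (m+1)) ≠ x (runStart x m)}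

def wlen {n : ℕ} (ω : Fin n → A × ℕ) : ℕ := ∑ i, (ω i).2

lemma runStart_of_cyl {n : ℕ} {ω : Fin n → A × ℕ} {x : ℕ → A} (hx : x ∈ Cyl ω) :
    runStart x n = wlen ω := by
  rw [runStart_eq_sum]
  exact Finset.sum_congr rfl fun i _ => by rw [hx.1 i]

lemma runStart_agree (x y : ℕ → A) (n L : ℕ) (hxy : ∀ i ≤ L, x i = y i)
    (hp : ∀ m < n, x (runStart x (m+1)) ≠ x (runStart x m)) (hL : runStart x n ≤ L) :
    ∀ m ≤ n, runStart y m = runStart x m := by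
  intro m
  induction m with
  | zero => intro _; simp [runStart]
  | succ m ih =>
    intro hm
    have h1 := ih (by omega)
    have h2 : runStart x (m+1) ≤ L := ((runStart_strictMono x).monotone hm).trans hL
    have h3 := runStart_lt_succ x m
    have h4 := hp m (by omega)
    have h5 : runStart y (m+1) = nextChange y (runStart x m) := by rw [← h1]; rfl
    rw [h5]
    apply nextChange_eq _ _ _ h3
    · rw [← hxy _ h2, ← hxy _ (by omega)]; exact h4
    · intro l h6 h7
      rw [← hxy _ (by omega), ← hxy _ (by omega)]
      exact nextChange_const x _ _ h6.le h7

lemma cyl_agree {n : ℕ} {ω : Fin n → A × ℕ} {G : ℕ} (hG : wlen ω ≤ G) (x y : ℕ → A)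
    (hxy : ∀ i ≤ G, x i = y i) (hx : x ∈ Cyl ω) : y ∈ Cyl ω := by
  have hL : runStart x n ≤ G := by rw [runStart_of_cyl hx]; exact hG
  have h := runStart_agree x y n G hxy hx.2 hL
  have hm : ∀ m ≤ n, runStart x m ≤ G := fun m hm => ((runStart_strictMono x).monotone hm).trans hL
  refine ⟨fun i => ?_, fun m hmn => ?_⟩
  · rw [← hx.1 i]
    unfold rle
    rw [h _ i.2.le, h _ i.2, hxy _ (hm _ i.2.le)]
  · rw [h _ hmn, h _ hmn.le, ← hxy _ (hm _ hmn), ← hxy _ (hm _ hmn.le)]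
    exact hx.2 m hmn

lemma cyl_disjoint {n : ℕ} {ω ω' : Fin n → A × ℕ} (h : ω ≠ ω') : Disjoint (Cyl ω) (Cyl ω') := by
  rw [Set.disjoint_left]
  intro x h1 h2
  exact h (funext fun i => by rw [← h1.1 i, h2.1 i])

/-- sequences that start like a member of the cylinder, up to the end of the last run -/
def Dyl {n : ℕ} (ω : Fin n → A × ℕ) : Set (ℕ → A) :=
  {x | ∃ y ∈ Cyl ω, ∀ i < wlen ω, y i = x i}

lemma cyl_append {n m : ℕ} (ω : Fin n → A × ℕ) (ω' : Fin m → A × ℕ) :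
    Cyl (Fin.append ω ω') ⊆ Dyl ω ∩ (sh (wlen ω)) ⁻¹' Cyl ω' := by
  intro x hx
  have h1 : x ∈ Cyl ω := by
    refine ⟨fun i => ?_, fun k hk => hx.2 k (by omega)⟩
    have := hx.1 (Fin.castAdd m i)
    rwa [Fin.append_left] at this
  refine ⟨⟨x, h1, fun _ _ => rfl⟩, ?_⟩
  rw [← runStart_of_cyl h1]
  refine ⟨fun i => ?_, fun k hk => ?_⟩
  · have := hx.1 (Fin.natAdd n i)
    rw [Fin.append_right] at this
    rw [rle_sh]
    exact this
  · simp only [sh]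
    rw [runStart_sh, runStart_sh]
    exact hx.2 (n + k) (by omega)

def incr {n : ℕ} (j : ℕ) (ω : Fin (n+1) → A × ℕ) : Fin (n+1) → A × ℕ :=
  Function.update ω (Fin.last n) ((ω (Fin.last n)).1, (ω (Fin.last n)).2 + j)

lemma incr_injective {n : ℕ} (j : ℕ) : Function.Injective (incr (A := A) (n := n) j) := by
  intro ω ω' h
  funext i
  have hi := congrFun h i
  unfold incr at hi
  by_cases hl : i = Fin.last n
  · subst hl
    simp only [Function.update_self, Prod.mk.injEq] at hi
    exact Prod.ext hi.1 (by omega)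
  · rwa [Function.update_of_ne hl, Function.update_of_ne hl] at hi

lemma dyl_subset {n : ℕ} (ω : Fin (n+1) → A × ℕ) (x : ℕ → A) (hx : x ∈ Dyl ω)
    (hT : x (wlen ω + 1) ≠ x (wlen ω + 2)) : ∃ j < 3, x ∈ Cyl (incr j ω) := by
  obtain ⟨y, hy, hxy⟩ := hx
  have hL := runStart_of_cyl hy
  have hlt := runStart_lt_succ y n
  have h := runStart_agree y x n (wlen ω - 1) (fun i hi => hxy i (by omega))
    (fun m hm => hy.2 m (by omega)) (by omega)
  have hs := h n le_rfl
  set s := runStart y n with hsdef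
  have hconst : ∀ l, s ≤ l → l < wlen ω → x l = x s := by
    intro l h1 h2
    rw [← hxy _ h2, ← hxy _ (by omega)]
    exact nextChange_const y _ _ h1 (by rw [← hL] at h2; exact h2)
  have hnext : ∃ j < 3, nextChange x s = wlen ω + j ∧ x (wlen ω + j) ≠ x s := by
    by_cases h0 : x (wlen ω) = x s
    · by_cases h1 : x (wlen ω + 1) = x s
      · refine ⟨2, by omega, nextChange_eq _ _ _ (by omega) ?_ ?_, ?_⟩
        · rw [← h1]; exact hT.symm
        · intro l h2 h3
          rcases lt_or_ge l (wlen ω) with h4 | h4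
          · exact hconst l h2.le h4
          · rcases h4.eq_or_lt with h5 | h5
            · rw [← h5]; exact h0
            · rw [show l = wlen ω + 1 by omega]; exact h1
        · rw [← h1]; exact hT.symm
      · refine ⟨1, by omega, nextChange_eq _ _ _ (by omega) h1 ?_, h1⟩
        intro l h2 h3
        rcases lt_or_ge l (wlen ω) with h4 | h4
        · exact hconst l h2.le h4
        · rw [show l = wlen ω by omega]; exact h0
    · refine ⟨0, by omega, nextChange_eq _ _ _ (by omega) h0 ?_, h0⟩
      intro l h2 h3
      exact hconst l h2.le h3
  obtain ⟨j, hj, hj1, hj2⟩ := hnext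
  have hlast : runStart x (n+1) = wlen ω + j := by rw [← hj1, ← hs]; rfl
  have hmono : ∀ m ≤ n, runStart y m ≤ s := fun m hm => (runStart_strictMono y).monotone hm
  refine ⟨j, hj, ?_, ?_⟩
  · intro i
    unfold incr
    by_cases hl : i = Fin.last n
    · subst hl
      rw [Function.update_self, ← hy.1 (Fin.last n)]
      unfold rle
      simp only [Fin.val_last]
      rw [hlast, hs, hL, ← hsdef, hxy s (by omega)]
      congr 1
      omega
    · rw [Function.update_of_ne hl, ← hy.1 i]
      have hi : (i : ℕ) < n := by
        have := i.2
        have : (i : ℕ) ≠ n := fun h => hl (Fin.ext h)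
        omega
      unfold rle
      have := hmono i hi.le
      rw [h _ hi.le, h _ hi, hxy _ (by omega)]
  · intro m hm
    rcases Nat.lt_succ_iff_lt_or_eq.1 hm with hm | rfl
    · have h1 := hmono m hm.le
      have h2 : runStart y (m+1) ≤ s := hmono (m+1) hm
      have h3 : s < wlen ω := by omega
      have hm' : m + 1 ≤ n := hm
      rw [h _ hm', h _ hm.le, ← hxy _ (by omega), ← hxy _ (by omega)]
      exact hy.2 m (by omega)
    · rw [hlast, hs]; exact hj2

lemma wlen_finite [Finite A] (n G : ℕ) : {ω : Fin n → A × ℕ | wlen ω ≤ G}.Finite := by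
  have : (Set.pi Set.univ fun _ : Fin n => (Set.univ : Set A) ×ˢ Set.Iic G).Finite :=
    Set.Finite.pi fun _ => Set.finite_univ.prod (Set.finite_Iic G)
  refine this.subset fun ω hω i _ => ⟨trivial, ?_⟩
  exact (Finset.single_le_sum (f := fun i => (ω i).2) (fun _ _ => Nat.zero_le _)
    (Finset.mem_univ i)).trans hω

variable [Fintype A] [MeasurableSpace A] [MeasurableSingletonClass A]

lemma meas_LE (G : ℕ) (S : Set (ℕ → A))
    (hS : ∀ x y : ℕ → A, (∀ i ≤ G, x i = y i) → x ∈ S → y ∈ S) :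
    MeasurableSet[cylAlgLE A G] S := by
  refine ⟨(fun x (i : Fin (G + 1)) => x i) '' S, (Set.toFinite _).measurableSet, ?_⟩
  ext y
  constructor
  · rintro ⟨x, hx, hxy⟩
    refine hS x y (fun i hi => ?_) hx
    exact congrFun hxy ⟨i, by omega⟩
  · intro hy
    exact ⟨y, hy, rfl⟩

lemma LE_le (G : ℕ) : cylAlgLE A G ≤ MeasurableSpace.pi := by
  apply Measurable.comap_le
  fun_prop

lemma cyl_meas_LE {n : ℕ} (ω : Fin n → A × ℕ) (G : ℕ) (hG : wlen ω ≤ G) :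
    MeasurableSet[cylAlgLE A G] (Cyl ω) :=
  meas_LE G _ fun x y => cyl_agree hG x y

lemma cyl_meas {n : ℕ} (ω : Fin n → A × ℕ) : MeasurableSet (Cyl ω) :=
  LE_le _ _ (cyl_meas_LE ω _ le_rfl)

lemma dyl_meas_LE {n : ℕ} (ω : Fin n → A × ℕ) (hn : 0 < wlen ω) :
    MeasurableSet[cylAlgLE A (wlen ω - 1)] (Dyl ω) := by
  refine meas_LE _ _ ?_
  rintro x y hxy ⟨z, hz, hzx⟩
  exact ⟨z, hz, fun i hi => by rw [hzx i hi, hxy i (by omega)]⟩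

lemma meas_GE (m : ℕ) (S : Set (ℕ → A)) (hS : MeasurableSet S) :
    MeasurableSet[cylAlgGE A m] (sh m ⁻¹' S) := by
  refine ⟨S, hS, ?_⟩
  ext x
  simp only [Set.mem_preimage]
  have : (fun i => x (m + i)) = sh m x := by funext t; simp [sh, add_comm]
  rw [this]

lemma sh_measurable (m : ℕ) : Measurable (sh (A := A) m) := by
  unfold sh; fun_prop

lemma sh_mp (μ : Measure (ℕ → A)) (hinv : MeasurePreserving (shift (A := A)) μ μ) (m : ℕ) :
    MeasurePreserving (sh (A := A) m) μ μ := by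
  induction m with
  | zero => exact MeasurePreserving.id μ
  | succ m ih =>
    have := hinv.comp ih
    convert this using 1
    funext x t
    simp [sh, shift]; congr 1; ring

lemma const_bound (μ : Measure (ℕ → A)) (c h : ℝ) (hA : HypA μ c h) (l : ℕ) :
    μ {x | ∀ t < l, x t = x 0} ≤ ENNReal.ofReal (Fintype.card A * (c * Real.exp (-h * l))) := by
  calc μ {x | ∀ t < l, x t = x 0} ≤ μ (⋃ a : A, {x | ∀ i < l, x i = a}) := by
        apply measure_mono
        intro x hx
        exact Set.mem_iUnion.2 ⟨x 0, hx⟩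
    _ ≤ ∑ a : A, μ {x | ∀ i < l, x i = a} := measure_iUnion_fintype_le _ _
    _ ≤ ∑ a : A, ENNReal.ofReal (c * Real.exp (-h * l)) := Finset.sum_le_sum fun a _ => hA.2.2 l a
    _ = _ := by
      rw [Finset.sum_const, Finset.card_univ, nsmul_eq_mul,
        ENNReal.ofReal_mul (p := (Fintype.card A : ℝ)) (by positivity), ENNReal.ofReal_natCast]

lemma const_meas (l : ℕ) : MeasurableSet {x : ℕ → A | ∀ t < l, x t = x 0} := by
  refine LE_le l _ (meas_LE l _ ?_)
  intro x y hxy hx t ht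
  rw [← hxy t (by omega), ← hxy 0 (by omega)]
  exact hx t ht

lemma longrun_bound (μ : Measure (ℕ → A)) (hinv : MeasurePreserving (shift (A := A)) μ μ)
    (c h : ℝ) (hA : HypA μ c h) (M l : ℕ) :
    μ {x | ∃ i < M, ∀ t < l, x (i + t) = x i} ≤
      ENNReal.ofReal (M * (Fintype.card A * (c * Real.exp (-h * l)))) := by
  calc μ {x | ∃ i < M, ∀ t < l, x (i + t) = x i}
      ≤ μ (⋃ i ∈ Finset.range M, sh i ⁻¹' {x : ℕ → A | ∀ t < l, x t = x 0}) := by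
        apply measure_mono
        rintro x ⟨i, hi, hx⟩
        simp only [Set.mem_iUnion, Finset.mem_range]
        refine ⟨i, hi, fun t ht => ?_⟩
        simp only [sh, zero_add]
        rw [add_comm]; exact hx t ht
    _ ≤ ∑ i ∈ Finset.range M, μ (sh i ⁻¹' {x : ℕ → A | ∀ t < l, x t = x 0}) :=
        measure_biUnion_finset_le _ _
    _ ≤ ∑ i ∈ Finset.range M, ENNReal.ofReal (Fintype.card A * (c * Real.exp (-h * l))) := by
        apply Finset.sum_le_sum
        intro i _
        rw [(sh_mp μ hinv i).measure_preimage (const_meas l).nullMeasurableSet]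
        exact const_bound μ c h hA l
    _ = _ := by
      rw [Finset.sum_const, Finset.card_range, nsmul_eq_mul,
        ENNReal.ofReal_mul (p := (M : ℝ)) (by positivity), ENNReal.ofReal_natCast]

lemma ae_nc (μ : Measure (ℕ → A)) (hinv : MeasurePreserving (shift (A := A)) μ μ)
    (c h : ℝ) (hA : HypA μ c h) : ∀ᵐ x ∂μ, ∀ i, ∃ t, x (i + t + 1) ≠ x i := by
  rw [ae_all_iff]
  intro i
  rw [ae_iff]
  have hb : ∀ l : ℕ, μ {x | ¬ ∃ t, x (i + t + 1) ≠ x i} ≤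
      ENNReal.ofReal ((i+1 : ℕ) * (Fintype.card A * (c * Real.exp (-h * l)))) := by
    intro l
    refine (measure_mono ?_).trans (longrun_bound μ hinv c h hA (i+1) l)
    intro x hx
    refine ⟨i, by omega, fun t _ => ?_⟩
    simp only [ne_eq, not_exists, not_not, Set.mem_ofPred_eq] at hx
    rcases t with _ | t
    · rfl
    · exact hx t
  have hlim : Tendsto (fun l : ℕ => ENNReal.ofReal ((i+1 : ℕ) * (Fintype.card A * (c * Real.exp (-h * l)))))
      atTop (𝓝 0) := by
    rw [← ENNReal.ofReal_zero]
    apply ENNReal.tendsto_ofReal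
    have h1 : Tendsto (fun l : ℕ => Real.exp (-h * l)) atTop (𝓝 0) := by
      apply Real.tendsto_exp_atBot.comp
      have := tendsto_natCast_atTop_atTop (R := ℝ)
      exact this.const_mul_atTop_of_neg (by linarith [hA.2.1])
    have := ((h1.const_mul c).const_mul (Fintype.card A : ℝ)).const_mul ((i+1 : ℕ) : ℝ)
    simpa using this
  exact le_antisymm (ge_of_tendsto' hlim hb) (zero_le)

lemma proper_of_nc {x : ℕ → A} (hx : ∀ i, ∃ t, x (i + t + 1) ≠ x i) (m : ℕ) :
    x (runStart x (m+1)) ≠ x (runStart x m) := nextChange_ne _ _ (hx _)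

lemma cyl_ae (μ : Measure (ℕ → A)) (hinv : MeasurePreserving (shift (A := A)) μ μ)
    (c h : ℝ) (hA : HypA μ c h) {n : ℕ} (ω : Fin n → A × ℕ) :
    μ {x | ∀ i : Fin n, rle x i = ω i} = μ (Cyl ω) := by
  apply measure_congr
  filter_upwards [ae_nc μ hinv c h hA] with x hx
  apply propext
  constructor
  · intro h; exact ⟨h, fun m _ => proper_of_nc hx m⟩
  · intro h; exact h.1
end cyl

open MeasureTheory Filter Topology
open scoped ENNReal

section ent
variable {A : Type*} [Fintype A] [MeasurableSpace A] [MeasurableSingletonClass A]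

noncomputable def SE (μ : Measure (ℕ → A)) (n : ℕ) : ℝ≥0∞ :=
  ∑' ω : Fin n → A × ℕ, μ (Cyl ω) ^ 2

lemma tsum_cyl (μ : Measure (ℕ → A)) [IsProbabilityMeasure μ]
    (hinv : MeasurePreserving (shift (A := A)) μ μ)
    (c h : ℝ) (hA : HypA μ c h) (n : ℕ) : ∑' ω : Fin n → A × ℕ, μ (Cyl ω) = 1 := by
  rw [← measure_iUnion (fun ω ω' h => cyl_disjoint h) (fun ω => cyl_meas ω)]
  rw [← measure_univ (μ := μ)]
  apply measure_congr
  filter_upwards [ae_nc μ hinv c h hA] with x hx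
  apply propext
  constructor
  · intro _; trivial
  · intro _
    exact Set.mem_iUnion.2 ⟨fun i => rle x i, fun i => rfl, fun m _ => proper_of_nc hx m⟩

lemma SE_le_one (μ : Measure (ℕ → A)) [IsProbabilityMeasure μ]
    (hinv : MeasurePreserving (shift (A := A)) μ μ)
    (c h : ℝ) (hA : HypA μ c h) (n : ℕ) : SE μ n ≤ 1 := by
  rw [← tsum_cyl μ hinv c h hA n]
  apply ENNReal.tsum_le_tsum
  intro ω
  rw [sq]
  exact mul_le_of_le_one_left' prob_le_one

lemma SE_ne_zero (μ : Measure (ℕ → A)) [IsProbabilityMeasure μ]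
    (hinv : MeasurePreserving (shift (A := A)) μ μ)
    (c h : ℝ) (hA : HypA μ c h) (n : ℕ) : SE μ n ≠ 0 := by
  intro h0
  have h1 := tsum_cyl μ hinv c h hA n
  rw [SE, ENNReal.tsum_eq_zero] at h0
  have : ∑' ω : Fin n → A × ℕ, μ (Cyl ω) = 0 := by
    rw [ENNReal.tsum_eq_zero]
    intro ω
    have := h0 ω
    simpa using this
  rw [this] at h1
  exact zero_ne_one h1

lemma push_eq (μ : Measure (ℕ → A)) [IsProbabilityMeasure μ]
    (hinv : MeasurePreserving (shift (A := A)) μ μ)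
    (c h : ℝ) (hA : HypA μ c h) (n : ℕ) : pushCylSum μ n = (SE μ n).toReal := by
  unfold pushCylSum SE
  rw [ENNReal.tsum_toReal_eq]
  · congr 1
    funext ω
    rw [cyl_ae μ hinv c h hA, ENNReal.toReal_pow]
  · intro ω
    exact ENNReal.pow_ne_top (measure_ne_top _ _)

lemma psi_upper (μ : Measure (ℕ → A)) [IsProbabilityMeasure μ] (a : ℝ) (hpsi : PsiMixingPoly μ a)
    (n g : ℕ) (hg : 1 ≤ g) (S T : Set (ℕ → A))
    (hS : MeasurableSet[cylAlgLE A n] S) (hT : MeasurableSet[cylAlgGE A (n + g)] T) :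
    (μ (S ∩ T)).toReal ≤ (1 + (g : ℝ) ^ (-a)) * (μ S).toReal * (μ T).toReal := by
  have := (abs_le.1 (hpsi n g hg S T hS hT)).2
  linarith

lemma psi_lower (μ : Measure (ℕ → A)) [IsProbabilityMeasure μ] (a : ℝ) (hpsi : PsiMixingPoly μ a)
    (n g : ℕ) (hg : 1 ≤ g) (S T : Set (ℕ → A))
    (hS : MeasurableSet[cylAlgLE A n] S) (hT : MeasurableSet[cylAlgGE A (n + g)] T) :
    (1 - (g : ℝ) ^ (-a)) * (μ S).toReal * (μ T).toReal ≤ (μ (S ∩ T)).toReal := by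
  have := (abs_le.1 (hpsi n g hg S T hS hT)).1
  linarith

lemma diff_meas : MeasurableSet {x : ℕ → A | x 0 ≠ x 1} := by
  refine LE_le 1 _ (meas_LE 1 _ ?_)
  intro x y hxy hx
  have h0 := hxy 0 (by omega)
  have h1 := hxy 1 (by omega)
  show y 0 ≠ y 1
  rw [← h0, ← h1]; exact hx

lemma diff_pos (μ : Measure (ℕ → A)) [IsProbabilityMeasure μ]
    (hinv : MeasurePreserving (shift (A := A)) μ μ)
    (c h : ℝ) (hA : HypA μ c h) : 0 < (μ {x : ℕ → A | x 0 ≠ x 1}).toReal := by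
  apply ENNReal.toReal_pos _ (measure_ne_top _ _)
  intro h0
  have h1 : ∀ᵐ x ∂μ, ∀ i, x i = x (i+1) := by
    rw [ae_all_iff]
    intro i
    rw [ae_iff]
    have := (sh_mp μ hinv i).measure_preimage diff_meas.nullMeasurableSet
    rw [h0] at this
    convert this using 2
    ext x
    simp [sh, add_comm]
  obtain ⟨x, hx1, hx2⟩ := (h1.and (ae_nc μ hinv c h hA)).exists
  obtain ⟨t, ht⟩ := hx2 0
  apply ht
  have : ∀ i, x i = x 0 := by
    intro i
    induction i with
    | zero => rfl
    | succ i ih => rw [← hx1 i, ih]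
  rw [this]

lemma dyl_bound (μ : Measure (ℕ → A)) [IsProbabilityMeasure μ]
    (hinv : MeasurePreserving (shift (A := A)) μ μ)
    (c h : ℝ) (hA : HypA μ c h) (a : ℝ) (ha : 0 < a) (hpsi : PsiMixingPoly μ a) :
    ∃ C : ℝ, 0 < C ∧ ∀ (n : ℕ) (ω : Fin (n+1) → A × ℕ),
      (μ (Dyl ω)).toReal ≤ C * ∑ j ∈ Finset.range 3, (μ (Cyl (incr j ω))).toReal := by
  have h2 : ((2 : ℕ) : ℝ) ^ (-a) < 1 := by
    apply Real.rpow_lt_one_of_one_lt_of_neg <;> norm_num; exact ha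
  have hτ := diff_pos μ hinv c h hA
  set τ := (μ {x : ℕ → A | x 0 ≠ x 1}).toReal with hτdef
  set q := 1 - ((2 : ℕ) : ℝ) ^ (-a) with hq
  have hq0 : 0 < q := by linarith
  refine ⟨(q * τ)⁻¹, by positivity, fun n ω => ?_⟩
  have hnn : 0 ≤ ∑ j ∈ Finset.range 3, (μ (Cyl (incr j ω))).toReal :=
    Finset.sum_nonneg fun _ _ => ENNReal.toReal_nonneg
  rcases Nat.eq_zero_or_pos (wlen ω) with h0 | h0
  · have : Dyl ω = ∅ := by
      rw [Set.eq_empty_iff_forall_notMem]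
      rintro x ⟨y, hy, -⟩
      have h1 := runStart_of_cyl hy
      have h3 := runStart_lt_succ y n
      omega
    rw [this]
    simp only [measure_empty, ENNReal.toReal_zero]
    positivity
  · have hT : MeasurableSet[cylAlgGE A (wlen ω - 1 + 2)]
        (sh (wlen ω - 1 + 2) ⁻¹' {x : ℕ → A | x 0 ≠ x 1}) := meas_GE _ _ diff_meas
    have key := psi_lower μ a hpsi (wlen ω - 1) 2 (by norm_num) _ _ (dyl_meas_LE ω h0) hT
    rw [(sh_mp μ hinv _).measure_preimage diff_meas.nullMeasurableSet, ← hq, ← hτdef] at key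
    have hsub : (μ (Dyl ω ∩ sh (wlen ω - 1 + 2) ⁻¹' {x : ℕ → A | x 0 ≠ x 1})).toReal ≤
        ∑ j ∈ Finset.range 3, (μ (Cyl (incr j ω))).toReal := by
      rw [← ENNReal.toReal_sum (fun _ _ => measure_ne_top _ _)]
      apply ENNReal.toReal_mono
      · exact (ENNReal.sum_lt_top.2 fun _ _ => measure_lt_top _ _).ne
      · refine (measure_mono ?_).trans (measure_biUnion_finset_le _ _)
        rintro x ⟨hx1, hx2⟩
        have hx3 : x (wlen ω + 1) ≠ x (wlen ω + 2) := by
          have h4 : x (0 + (wlen ω - 1 + 2)) ≠ x (1 + (wlen ω - 1 + 2)) := hx2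
          rwa [show 0 + (wlen ω - 1 + 2) = wlen ω + 1 by omega,
            show 1 + (wlen ω - 1 + 2) = wlen ω + 2 by omega] at h4
        obtain ⟨j, hj, hj2⟩ := dyl_subset ω x hx1 hx3
        simp only [Set.mem_iUnion, Finset.mem_range]
        exact ⟨j, hj, hj2⟩
    rw [inv_mul_eq_div, le_div_iff₀ (by positivity)]
    calc (μ (Dyl ω)).toReal * (q * τ) = q * (μ (Dyl ω)).toReal * τ := by ring
      _ ≤ _ := key.trans hsub

lemma toReal_sq_le {x y : ℝ≥0∞} (hx : x ≠ ∞) (h : x.toReal ^ 2 ≤ y.toReal) (hy : y ≠ ∞) :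
    x ^ 2 ≤ y := by
  rw [← ENNReal.toReal_pow] at h
  exact (ENNReal.toReal_le_toReal (ENNReal.pow_ne_top hx) hy).1 h

lemma dyl_sum (μ : Measure (ℕ → A)) [IsProbabilityMeasure μ]
    (hinv : MeasurePreserving (shift (A := A)) μ μ)
    (c h : ℝ) (hA : HypA μ c h) (a : ℝ) (ha : 0 < a) (hpsi : PsiMixingPoly μ a) :
    ∃ C : ℝ, 0 < C ∧ ∀ (n : ℕ),
      ∑' ω : Fin (n+1) → A × ℕ, μ (Dyl ω) ^ 2 ≤ ENNReal.ofReal C * SE μ (n+1) := by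
  obtain ⟨C, hC, hb⟩ := dyl_bound μ hinv c h hA a ha hpsi
  refine ⟨C ^ 2 * 9, by positivity, fun n => ?_⟩
  have h1 : ∀ ω : Fin (n+1) → A × ℕ, μ (Dyl ω) ^ 2 ≤
      ENNReal.ofReal (C ^ 2 * 3) * ∑ j ∈ Finset.range 3, μ (Cyl (incr j ω)) ^ 2 := by
    intro ω
    have hfin : ∑ j ∈ Finset.range 3, μ (Cyl (incr j ω)) ^ 2 ≠ ∞ :=
      (ENNReal.sum_lt_top.2 fun _ _ => (ENNReal.pow_ne_top (measure_ne_top _ _)).lt_top).ne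
    apply toReal_sq_le (measure_ne_top _ _) _ (ENNReal.mul_ne_top ENNReal.ofReal_ne_top hfin)
    rw [ENNReal.toReal_mul, ENNReal.toReal_ofReal (by positivity),
      ENNReal.toReal_sum (fun _ _ => ENNReal.pow_ne_top (measure_ne_top _ _))]
    simp only [ENNReal.toReal_pow]
    calc (μ (Dyl ω)).toReal ^ 2 ≤ (C * ∑ j ∈ Finset.range 3, (μ (Cyl (incr j ω))).toReal) ^ 2 :=
          pow_le_pow_left₀ ENNReal.toReal_nonneg (hb n ω) 2
      _ = C ^ 2 * (∑ j ∈ Finset.range 3, (μ (Cyl (incr j ω))).toReal) ^ 2 := by ring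
      _ ≤ C ^ 2 * ((Finset.range 3).card * ∑ j ∈ Finset.range 3, (μ (Cyl (incr j ω))).toReal ^ 2) := by
          gcongr
          exact sq_sum_le_card_mul_sum_sq
      _ = _ := by simp; ring
  calc ∑' ω : Fin (n+1) → A × ℕ, μ (Dyl ω) ^ 2
      ≤ ∑' ω : Fin (n+1) → A × ℕ, ENNReal.ofReal (C ^ 2 * 3) *
          ∑ j ∈ Finset.range 3, μ (Cyl (incr j ω)) ^ 2 := ENNReal.tsum_le_tsum h1
    _ = ENNReal.ofReal (C ^ 2 * 3) * ∑ j ∈ Finset.range 3,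
          ∑' ω : Fin (n+1) → A × ℕ, μ (Cyl (incr j ω)) ^ 2 := by
        rw [ENNReal.tsum_mul_left]
        congr 1
        exact Summable.tsum_finsetSum (fun _ _ => ENNReal.summable)
    _ ≤ ENNReal.ofReal (C ^ 2 * 3) * ∑ j ∈ Finset.range 3, SE μ (n+1) := by
        gcongr with j hj
        exact ENNReal.tsum_comp_le_tsum_of_injective (incr_injective j) _
    _ = _ := by
        rw [Finset.sum_const, Finset.card_range, nsmul_eq_mul, ← mul_assoc]
        congr 1
        rw [show C^2*9 = C^2*3*3 by ring, ENNReal.ofReal_mul (p := C^2*3) (by positivity)]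
        norm_num

lemma SE_submul (μ : Measure (ℕ → A)) [IsProbabilityMeasure μ]
    (hinv : MeasurePreserving (shift (A := A)) μ μ)
    (c h : ℝ) (hA : HypA μ c h) (a : ℝ) (ha : 0 < a) (hpsi : PsiMixingPoly μ a) :
    ∃ K : ℝ, 1 ≤ K ∧ ∀ n m : ℕ, SE μ (n + m) ≤ ENNReal.ofReal K * (SE μ n * SE μ m) := by
  obtain ⟨C, hC, hb⟩ := dyl_sum μ hinv c h hA a ha hpsi
  refine ⟨max 1 (4 * C), le_max_left _ _, fun n m => ?_⟩
  rcases n with _ | n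
  · have h0 : SE μ 0 = 1 := by
      have h1 := tsum_cyl μ hinv c h hA 0
      rw [tsum_fintype, Fintype.sum_unique] at h1
      rw [SE, tsum_fintype, Fintype.sum_unique, h1, one_pow]
    rw [h0, one_mul, zero_add]
    calc SE μ m = ENNReal.ofReal 1 * SE μ m := by simp
      _ ≤ _ := by gcongr; exact le_max_left _ _
  · have h1 : ∀ (ω : Fin (n+1) → A × ℕ) (ω' : Fin m → A × ℕ),
        μ (Cyl (Fin.append ω ω')) ^ 2 ≤ 4 * (μ (Dyl ω) ^ 2 * μ (Cyl ω') ^ 2) := by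
      intro ω ω'
      have h2 : μ (Cyl (Fin.append ω ω')) ≤ 2 * (μ (Dyl ω) * μ (Cyl ω')) := by
        refine (measure_mono (cyl_append ω ω')).trans ?_
        rcases Nat.eq_zero_or_pos (wlen ω) with h0 | h0
        · have : Dyl ω = ∅ := by
            rw [Set.eq_empty_iff_forall_notMem]
            rintro x ⟨y, hy, -⟩
            have h1 := runStart_of_cyl hy
            have h3 := runStart_lt_succ y n
            omega
          simp [this]
        · have hT := meas_GE (wlen ω) _ (cyl_meas ω')
          have key := psi_upper μ a hpsi (wlen ω - 1) 1 le_rfl _ (sh (wlen ω) ⁻¹' Cyl ω')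
            (dyl_meas_LE ω h0) (by rw [show wlen ω - 1 + 1 = wlen ω by omega]; exact hT)
          rw [(sh_mp μ hinv _).measure_preimage (cyl_meas ω').nullMeasurableSet] at key
          rw [← ENNReal.toReal_le_toReal (measure_ne_top _ _) (by finiteness)]
          refine key.trans (le_of_eq ?_)
          rw [ENNReal.toReal_mul, ENNReal.toReal_mul]
          norm_num
          ring
      calc μ (Cyl (Fin.append ω ω')) ^ 2 ≤ (2 * (μ (Dyl ω) * μ (Cyl ω'))) ^ 2 := by gcongr
        _ = _ := by rw [mul_pow, mul_pow]; norm_num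
    calc SE μ (n + 1 + m) = ∑' p : (Fin (n+1) → A × ℕ) × (Fin m → A × ℕ),
            μ (Cyl (Fin.append p.1 p.2)) ^ 2 := by
          rw [SE, ← (Fin.appendEquiv (n+1) m).tsum_eq]
          rfl
      _ = ∑' ω : Fin (n+1) → A × ℕ, ∑' ω' : Fin m → A × ℕ, μ (Cyl (Fin.append ω ω')) ^ 2 :=
          ENNReal.tsum_prod (f := fun ω ω' => μ (Cyl (Fin.append ω ω')) ^ 2)
      _ ≤ ∑' ω : Fin (n+1) → A × ℕ, ∑' ω' : Fin m → A × ℕ, 4 * (μ (Dyl ω) ^ 2 * μ (Cyl ω') ^ 2) :=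
          ENNReal.tsum_le_tsum fun ω => ENNReal.tsum_le_tsum fun ω' => h1 ω ω'
      _ = 4 * ((∑' ω : Fin (n+1) → A × ℕ, μ (Dyl ω) ^ 2) * SE μ m) := by
          simp_rw [ENNReal.tsum_mul_left]
          rw [ENNReal.tsum_mul_right]
          rfl
      _ ≤ 4 * ((ENNReal.ofReal C * SE μ (n+1)) * SE μ m) := by
          gcongr
          exact hb n
      _ = ENNReal.ofReal (4 * C) * (SE μ (n+1) * SE μ m) := by
          rw [ENNReal.ofReal_mul (by norm_num)]
          norm_num
          ring
      _ ≤ _ := by gcongr; exact le_max_right _ _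

/-- The Rényi entropy exists. -/
lemma entropy_exists (μ : Measure (ℕ → A)) [IsProbabilityMeasure μ]
    (hinv : MeasurePreserving (shift (A := A)) μ μ)
    (c h : ℝ) (hA : HypA μ c h) (a : ℝ) (ha : 0 < a) (hpsi : PsiMixingPoly μ a)
    (hH : 0 < H2lower μ) :
    ∃ H : ℝ, 0 < H ∧ H2lower μ = H ∧ H2upper μ = H ∧
      Tendsto (fun n : ℕ => Real.log (pushCylSum μ n) / n) atTop (𝓝 (-H)) := by
  obtain ⟨K, hK, hsub⟩ := SE_submul μ hinv c h hA a ha hpsi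
  have hpos : ∀ n, 0 < pushCylSum μ n := by
    intro n
    rw [push_eq μ hinv c h hA]
    exact ENNReal.toReal_pos (SE_ne_zero μ hinv c h hA n)
      ((SE_le_one μ hinv c h hA n).trans_lt ENNReal.one_lt_top).ne
  have hfin : ∀ n, SE μ n ≠ ∞ := fun n => ((SE_le_one μ hinv c h hA n).trans_lt ENNReal.one_lt_top).ne
  have hs : Subadditive (fun n => Real.log (pushCylSum μ n) + Real.log K) := by
    intro n m
    have h1 : pushCylSum μ (n + m) ≤ K * (pushCylSum μ n * pushCylSum μ m) := by
      rw [push_eq μ hinv c h hA, push_eq μ hinv c h hA, push_eq μ hinv c h hA]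
      have := ENNReal.toReal_mono (by have := hfin n; have := hfin m; finiteness) (hsub n m)
      rwa [ENNReal.toReal_mul, ENNReal.toReal_mul, ENNReal.toReal_ofReal (by linarith)] at this
    have h2 := Real.log_le_log (hpos _) h1
    have := hpos n
    have := hpos m
    rw [Real.log_mul (by positivity) (by positivity), Real.log_mul (by positivity) (by positivity)] at h2
    linarith
  have hne : {b : ℝ | ∀ᶠ n : ℕ in atTop, b ≤ Real.log (pushCylSum μ n) / n}.Nonempty := by
    by_contra hemp
    rw [Set.not_nonempty_iff_eq_empty] at hemp
    rw [H2lower, liminf_eq, hemp] at hH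
    simp at hH
  obtain ⟨b, hb⟩ := hne
  have hlogK : 0 ≤ Real.log K := Real.log_nonneg hK
  have hbdd : BddBelow (Set.range fun n : ℕ => (Real.log (pushCylSum μ n) + Real.log K) / n) := by
    have : IsBoundedUnder (· ≥ ·) atTop (fun n : ℕ => (Real.log (pushCylSum μ n) + Real.log K) / n) := by
      refine ⟨b, ?_⟩
      rw [eventually_map]
      filter_upwards [hb] with n hn
      have : 0 ≤ Real.log K / n := by positivity
      rw [add_div]
      linarith
    exact this.bddBelow_range
  have hlim := hs.tendsto_lim hbdd
  have hlim2 : Tendsto (fun n : ℕ => Real.log (pushCylSum μ n) / n) atTop (𝓝 hs.lim) := by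
    have h1 : Tendsto (fun n : ℕ => Real.log K / n) atTop (𝓝 0) :=
      tendsto_const_nhds.div_atTop tendsto_natCast_atTop_atTop
    have := hlim.sub h1
    rw [sub_zero] at this
    refine this.congr fun n => ?_
    rw [add_div]; ring
  have hl : H2lower μ = -hs.lim := by rw [H2lower, hlim2.liminf_eq]
  have hu : H2upper μ = -hs.lim := by rw [H2upper, hlim2.limsup_eq]
  refine ⟨-hs.lim, by rw [← hl]; exact hH, hl, hu, by rw [neg_neg]; exact hlim2⟩
end ent

open MeasureTheory Filter Topology
open scoped ENNReal

section second
variable {Ω ι : Type*} [MeasurableSpace Ω]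

lemma second_moment (μ : Measure Ω) [IsProbabilityMeasure μ] (W : Finset ι)
    (E : ι → ℕ → Set Ω) (hE : ∀ w a, MeasurableSet (E w a)) (p : ι → ℝ)
    (hp : ∀ w ∈ W, ∀ a, μ.real (E w a) = p w)
    (hdis : ∀ w ∈ W, ∀ w' ∈ W, w ≠ w' → ∀ a, Disjoint (E w a) (E w' a)) (ψ : ℝ) (hψ0 : 0 ≤ ψ) (hψ1 : ψ ≤ 1)
    (hmix : ∀ w ∈ W, ∀ w' ∈ W, ∀ a a', a ≠ a' → μ.real (E w a ∩ E w' a') ≤ (1 + ψ) * (p w * p w'))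
    (R : ℕ) (hR : 0 < R) (v : ℝ) (hv : 0 < v) (hT : ∑ w ∈ W, p w ^ 2 = v ^ 2) :
    (μ.prod μ).real {z | ∀ a < R, ∀ b < R, ∀ w ∈ W, ¬ (z.1 ∈ E w a ∧ z.2 ∈ E w b)} ≤
      3 * ψ + 4 / (R * v) + 1 / (R * v) ^ 2 := by
  classical
  have hInd : ∀ s : Set Ω, MeasurableSet s → Integrable (fun x => s.indicator (1 : Ω → ℝ) x) μ :=
    fun s hs => (integrable_const (1:ℝ)).indicator hs
  have hp0 : ∀ w ∈ W, 0 ≤ p w := fun w hw => by rw [← hp w hw 0]; exact measureReal_nonneg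
  have hpv : ∀ w ∈ W, p w ≤ v := by
    intro w hw
    apply le_of_sq_le_sq _ hv.le
    rw [← hT]
    exact Finset.single_le_sum (f := fun w => p w ^ 2) (fun _ _ => sq_nonneg _) hw
  set U : ι → Ω → ℝ := fun w x => ∑ a ∈ Finset.range R, (E w a).indicator 1 x with hU
  have hUi : ∀ w, Integrable (U w) μ := fun w =>
    integrable_finset_sum _ fun a _ => hInd _ (hE w a)
  have hUI : ∀ w ∈ W, ∫ x, U w x ∂μ = R * p w := by
    intro w hw
    simp only [hU]
    rw [integral_finset_sum _ fun a _ => hInd _ (hE w a)]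
    simp_rw [integral_indicator_one (hE w _), hp w hw]
    simp
  have hUU : ∀ w w', (fun x => U w x * U w' x) = fun x => ∑ a ∈ Finset.range R,
      ∑ a' ∈ Finset.range R, (E w a ∩ E w' a').indicator (1 : Ω → ℝ) x := by
    intro w w'
    funext x
    simp only [hU]
    rw [Finset.sum_mul_sum]
    refine Finset.sum_congr rfl fun a _ => Finset.sum_congr rfl fun a' _ => ?_
    rw [Set.inter_indicator_one]; rfl
  have hUUi : ∀ w w', Integrable (fun x => U w x * U w' x) μ := by
    intro w w'
    rw [hUU]
    exact integrable_finset_sum _ fun a _ => integrable_finset_sum _ fun a' _ =>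
      hInd _ ((hE w a).inter (hE w' a'))
  have hUU0 : ∀ w w', 0 ≤ ∫ x, U w x * U w' x ∂μ := by
    intro w w'
    rw [hUU]
    apply integral_nonneg
    intro x
    exact Finset.sum_nonneg fun a _ => Finset.sum_nonneg fun a' _ =>
      Set.indicator_nonneg (fun _ _ => zero_le_one) _
  have hUUI : ∀ w ∈ W, ∀ w' ∈ W, ∫ x, U w x * U w' x ∂μ ≤
      (if w = w' then R * p w else 0) + (1 + ψ) * R ^ 2 * (p w * p w') := by
    intro w hw w' hw'
    rw [hUU, integral_finset_sum _ fun a _ => integrable_finset_sum _ fun a' _ =>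
      hInd _ ((hE w a).inter (hE w' a'))]
    have h1 : ∀ a ∈ Finset.range R, ∫ x, ∑ a' ∈ Finset.range R,
        (E w a ∩ E w' a').indicator (1 : Ω → ℝ) x ∂μ ≤
        (if w = w' then p w else 0) + R * ((1 + ψ) * (p w * p w')) := by
      intro a ha
      rw [integral_finset_sum _ fun a' _ =>
        hInd _ ((hE w a).inter (hE w' a'))]
      simp_rw [integral_indicator_one ((hE w a).inter (hE w' _))]
      have h2 : ∀ a' ∈ Finset.range R, μ.real (E w a ∩ E w' a') ≤
          (if a = a' then (if w = w' then p w else 0) else 0) + (1 + ψ) * (p w * p w') := by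
        intro a' _
        have h3 : 0 ≤ (1 + ψ) * (p w * p w') :=
          mul_nonneg (by linarith) (mul_nonneg (hp0 w hw) (hp0 w' hw'))
        by_cases haa : a = a'
        · subst haa
          by_cases hww : w = w'
          · subst hww
            simp only [if_true, Set.inter_self, hp w hw]
            linarith
          · rw [(hdis w hw w' hw' hww a).inter_eq]
            simpa [hww] using h3
        · rw [if_neg haa, zero_add]
          exact hmix w hw w' hw' a a' haa
      refine (Finset.sum_le_sum h2).trans (le_of_eq ?_)
      rw [Finset.sum_add_distrib, Finset.sum_ite_eq, if_pos ha]
      simp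
    refine (Finset.sum_le_sum h1).trans (le_of_eq ?_)
    simp only [Finset.sum_const, Finset.card_range, nsmul_eq_mul]
    split_ifs <;> ring
  set S : Ω × Ω → ℝ := fun z => ∑ w ∈ W, U w z.1 * U w z.2 with hS
  have hSi : Integrable S (μ.prod μ) := integrable_finset_sum _ fun w _ => (hUi w).mul_prod (hUi w)
  have hSI : ∫ z, S z ∂(μ.prod μ) = (R * v) ^ 2 := by
    simp only [hS]
    rw [integral_finset_sum _ fun w _ => (hUi w).mul_prod (hUi w)]
    simp_rw [integral_prod_mul (U _) (U _)]
    rw [Finset.sum_congr rfl fun w hw => by rw [hUI w hw]]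
    rw [mul_pow, ← hT, Finset.mul_sum]
    exact Finset.sum_congr rfl fun w _ => by ring
  have hS2 : (fun z => S z ^ 2) = fun z => ∑ w ∈ W, ∑ w' ∈ W,
      (U w z.1 * U w' z.1) * (U w z.2 * U w' z.2) := by
    funext z
    simp only [hS]
    rw [sq, Finset.sum_mul_sum]
    exact Finset.sum_congr rfl fun a _ => Finset.sum_congr rfl fun a' _ => by ring
  have hS2i : Integrable (fun z => S z ^ 2) (μ.prod μ) := by
    rw [hS2]
    exact integrable_finset_sum _ fun w _ => integrable_finset_sum _ fun w' _ =>
      (hUUi w w').mul_prod (hUUi w w')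
  have hS2I : ∫ z, S z ^ 2 ∂(μ.prod μ) ≤
      (R * v) ^ 2 + 2 * (1 + ψ) * (R * v) ^ 3 + (1 + ψ) ^ 2 * (R * v) ^ 4 := by
    rw [hS2, integral_finset_sum _ fun w _ => integrable_finset_sum _ fun w' _ =>
      (hUUi w w').mul_prod (hUUi w w')]
    have h1 : ∀ w ∈ W, ∫ z, ∑ w' ∈ W, (U w z.1 * U w' z.1) * (U w z.2 * U w' z.2) ∂(μ.prod μ) ≤
        (R ^ 2 * p w ^ 2 + 2 * (1 + ψ) * R ^ 3 * (v * p w ^ 2)) + (1 + ψ) ^ 2 * R ^ 4 * (p w ^ 2 * v ^ 2) := by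
      intro w hw
      rw [integral_finset_sum _ fun w' _ => (hUUi w w').mul_prod (hUUi w w')]
      rw [Finset.sum_congr rfl fun w' _ => integral_prod_mul (fun x => U w x * U w' x) (fun x => U w x * U w' x)]
      have h2 : ∀ w' ∈ W, (∫ x, U w x * U w' x ∂μ) * (∫ x, U w x * U w' x ∂μ) ≤
          (if w = w' then R ^ 2 * p w ^ 2 + 2 * (1 + ψ) * R ^ 3 * (v * p w ^ 2) else 0) +
            (1 + ψ) ^ 2 * R ^ 4 * (p w ^ 2 * p w' ^ 2) := by
        intro w' hw'
        have h3 := hUUI w hw w' hw'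
        refine (mul_self_le_mul_self (hUU0 w w') h3).trans ?_
        by_cases hww : w = w'
        · subst hww
          simp only [if_true]
          have h4 : p w ^ 3 ≤ v * p w ^ 2 := by
            rw [pow_succ']; exact mul_le_mul_of_nonneg_right (hpv w hw) (sq_nonneg _)
          have h5 : 0 ≤ 2 * (1 + ψ) * (R : ℝ) ^ 3 := by positivity
          have := mul_le_mul_of_nonneg_left h4 h5
          nlinarith
        · simp only [if_neg hww]
          apply le_of_eq; ring
      refine (Finset.sum_le_sum h2).trans (le_of_eq ?_)
      rw [Finset.sum_add_distrib, Finset.sum_ite_eq, if_pos hw, ← hT, Finset.mul_sum, Finset.mul_sum]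
    refine (Finset.sum_le_sum h1).trans (le_of_eq ?_)
    rw [Finset.sum_add_distrib, Finset.sum_add_distrib, ← Finset.mul_sum, ← Finset.mul_sum,
      ← Finset.mul_sum, ← Finset.mul_sum, ← Finset.sum_mul, hT]
    ring
  set m : ℝ := (R * v) ^ 2 with hm
  have hRv : 0 < (R : ℝ) * v := by positivity
  have hvar : ∫ z, (S z - m) ^ 2 ∂(μ.prod μ) ≤
      (R * v) ^ 2 + 4 * (R * v) ^ 3 + 3 * ψ * (R * v) ^ 4 := by
    have h1 : (fun z => (S z - m) ^ 2) = fun z => (S z ^ 2 - 2 * m * S z) + m ^ 2 := by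
      funext z; ring
    have hsi : Integrable (fun z => S z ^ 2 - 2 * m * S z) (μ.prod μ) := hS2i.sub (hSi.const_mul _)
    rw [h1, integral_add hsi (integrable_const _),
      integral_sub hS2i (hSi.const_mul _), integral_const_mul, hSI]
    simp only [integral_const, probReal_univ, one_smul, smul_eq_mul]
    have h2 : 0 ≤ (R * v) ^ 3 := by positivity
    have h3 : 0 ≤ (R * v) ^ 4 := by positivity
    have h4 : ψ * (R * v) ^ 3 ≤ (R * v) ^ 3 := mul_le_of_le_one_left h2 hψ1
    have h5 : ψ ^ 2 * (R * v) ^ 4 ≤ ψ * (R * v) ^ 4 :=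
      mul_le_mul_of_nonneg_right (by nlinarith) h3
    have h6 : m ^ 2 = (R * v) ^ 4 := by rw [hm]; ring
    nlinarith
  have hvi : Integrable (fun z => (S z - m) ^ 2) (μ.prod μ) := by
    have h1 : (fun z => (S z - m) ^ 2) = fun z => (S z ^ 2 - 2 * m * S z) + m ^ 2 := by
      funext z; ring
    rw [h1]
    exact (hS2i.sub (hSi.const_mul _)).add (integrable_const _)
  have hmark := mul_meas_ge_le_integral_of_nonneg (Eventually.of_forall fun z => sq_nonneg (S z - m)) hvi (m ^ 2)
  have hsub : (μ.prod μ).real {z | ∀ a < R, ∀ b < R, ∀ w ∈ W, ¬ (z.1 ∈ E w a ∧ z.2 ∈ E w b)} ≤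
      (μ.prod μ).real {z | m ^ 2 ≤ (S z - m) ^ 2} := by
    refine measureReal_mono ?_ (measure_ne_top _ _)
    intro z hz
    have : S z = 0 := by
      simp only [hS, hU]
      refine Finset.sum_eq_zero fun w hw => ?_
      rw [Finset.sum_mul_sum]
      refine Finset.sum_eq_zero fun a ha => Finset.sum_eq_zero fun b hb => ?_
      have := hz a (Finset.mem_range.1 ha) b (Finset.mem_range.1 hb) w hw
      by_cases h1 : z.1 ∈ E w a
      · have h2 : z.2 ∉ E w b := fun h2 => this ⟨h1, h2⟩
        simp [h2]
      · simp [h1]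
    show m ^ 2 ≤ (S z - m) ^ 2
    rw [this]; simp
  refine hsub.trans ?_
  have hm0 : 0 < m ^ 2 := by positivity
  have h7 : (μ.prod μ).real {z | m ^ 2 ≤ (S z - m) ^ 2} ≤
      ((R * v) ^ 2 + 4 * (R * v) ^ 3 + 3 * ψ * (R * v) ^ 4) / m ^ 2 := by
    rw [le_div_iff₀ hm0, mul_comm]
    exact hmark.trans hvar
  refine h7.trans (le_of_eq ?_)
  rw [hm]
  field_simp
  ring
end second

open MeasureTheory Filter Topology
open scoped ENNReal

section prob
variable {A : Type*}

lemma matchLen_bdd {C : Type*} (u v : ℕ → C) (n : ℕ) :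
    BddAbove {k | ∃ i j, i + k ≤ n ∧ j + k ≤ n ∧ ∀ m < k, u (i + m) = v (j + m)} :=
  ⟨n, by rintro k ⟨i, j, h, -⟩; omega⟩

lemma MRLE_ge (x y : ℕ → A) (hx : ∀ i, ∃ t, x (i + t + 1) ≠ x i)
    (hy : ∀ i, ∃ t, y (i + t + 1) ≠ y i) (k i j n : ℕ) (hi : i + k ≤ n) (hj : j + k ≤ n)
    (hm : ∀ m < k, rle (sh i x) m = rle (sh j y) m) : k ≤ MRLE x y n + 1 := by
  rcases k with _ | k
  · omega
  obtain ⟨r, hr, hr2⟩ := rle_pos x hx i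
  obtain ⟨s, hs, hs2⟩ := rle_pos y hy j
  have : k ≤ MRLE x y n := by
    apply le_csSup (matchLen_bdd _ _ _)
    refine ⟨r + 1, s + 1, by omega, by omega, fun m hmk => ?_⟩
    rw [← hr2, ← hs2]
    exact hm _ (by omega)
  omega

lemma MRLE_lt (x y : ℕ → A) (k N l : ℕ) (hk : 0 < k) (hl : 0 < l)
    (hx : ∀ i < N * l, ∃ t < l, x (i + t) ≠ x i)
    (hy : ∀ i < N * l, ∃ t < l, y (i + t) ≠ y i)
    (hno : ¬ ∃ s ≤ N * l, ∃ t ≤ N * l, ∀ m < k, rle (sh s x) m = rle (sh t y) m) (n : ℕ) (hn : n ≤ N) :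
    MRLE x y n < k := by
  by_contra hge
  push Not at hge
  obtain ⟨i, j, hi, hj, hm⟩ := Nat.sSup_mem (s := {k | ∃ i j, i + k ≤ n ∧ j + k ≤ n ∧
    ∀ m < k, rle x (i + m) = rle y (j + m)}) ⟨0, 0, 0, by simp⟩ (matchLen_bdd _ _ _)
  change i + MRLE x y n ≤ n at hi
  change j + MRLE x y n ≤ n at hj
  change ∀ m < MRLE x y n, _ at hm
  apply hno
  have h1 := runStart_le x N l hl hx i (by omega)
  have h2 := runStart_le y N l hl hy j (by omega)
  refine ⟨runStart x i, h1.trans (Nat.mul_le_mul_right _ (by omega)), runStart y j,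
    h2.trans (Nat.mul_le_mul_right _ (by omega)), fun m hmk => ?_⟩
  rw [rle_sh, rle_sh]
  exact hm m (by omega)

variable [Fintype A] [MeasurableSpace A] [MeasurableSingletonClass A]

lemma cyl_aeEq (μ : Measure (ℕ → A)) (hinv : MeasurePreserving (shift (A := A)) μ μ)
    (c h : ℝ) (hA : HypA μ c h) {n : ℕ} (ω : Fin n → A × ℕ) :
    {x | ∀ i : Fin n, rle x i = ω i} =ᵐ[μ] Cyl ω := by
  filter_upwards [ae_nc μ hinv c h hA] with x hx
  apply propext
  constructor
  · intro h; exact ⟨h, fun m _ => proper_of_nc hx m⟩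
  · intro h; exact h.1

lemma match_bound (μ : Measure (ℕ → A)) [IsProbabilityMeasure μ]
    (hinv : MeasurePreserving (shift (A := A)) μ μ)
    (c h : ℝ) (hA : HypA μ c h) (k P : ℕ) :
    (μ.prod μ) {z | ∃ s ≤ P, ∃ t ≤ P, ∀ m < k, rle (sh s z.1) m = rle (sh t z.2) m} ≤
      ((P + 1 : ℕ) : ℝ≥0∞) ^ 2 * SE μ k := by
  have h1 : ∀ s t : ℕ, (μ.prod μ) {z | ∀ m < k, rle (sh s z.1) m = rle (sh t z.2) m} ≤ SE μ k := by
    intro s t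
    have hmeas : ∀ (s : ℕ) (ω : Fin k → A × ℕ),
        μ (sh s ⁻¹' {x | ∀ i : Fin k, rle x i = ω i}) = μ (Cyl ω) := by
      intro s ω
      rw [(sh_mp μ hinv s).measure_preimage
        ((cyl_meas ω).nullMeasurableSet.congr (cyl_aeEq μ hinv c h hA ω).symm),
        cyl_ae μ hinv c h hA]
    calc (μ.prod μ) {z | ∀ m < k, rle (sh s z.1) m = rle (sh t z.2) m}
        ≤ (μ.prod μ) (⋃ ω : Fin k → A × ℕ, (sh s ⁻¹' {x | ∀ i : Fin k, rle x i = ω i}) ×ˢ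
            (sh t ⁻¹' {x | ∀ i : Fin k, rle x i = ω i})) := by
          apply measure_mono
          intro z hz
          refine Set.mem_iUnion.2 ⟨fun i => rle (sh s z.1) i, fun i => rfl, fun i => ?_⟩
          exact (hz i i.2).symm
      _ ≤ ∑' ω : Fin k → A × ℕ, (μ.prod μ) ((sh s ⁻¹' {x | ∀ i : Fin k, rle x i = ω i}) ×ˢ
            (sh t ⁻¹' {x | ∀ i : Fin k, rle x i = ω i})) := measure_iUnion_le _
      _ = SE μ k := by
          unfold SE
          congr 1
          funext ω
          rw [Measure.prod_prod, hmeas, hmeas, sq]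
  calc (μ.prod μ) {z | ∃ s ≤ P, ∃ t ≤ P, ∀ m < k, rle (sh s z.1) m = rle (sh t z.2) m}
      ≤ (μ.prod μ) (⋃ s ∈ Finset.range (P+1), ⋃ t ∈ Finset.range (P+1),
          {z | ∀ m < k, rle (sh s z.1) m = rle (sh t z.2) m}) := by
        apply measure_mono
        rintro z ⟨s, hs, t, ht, hz⟩
        simp only [Set.mem_iUnion, Finset.mem_range]
        exact ⟨s, by omega, t, by omega, hz⟩
    _ ≤ ∑ s ∈ Finset.range (P+1), (μ.prod μ) (⋃ t ∈ Finset.range (P+1),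
          {z | ∀ m < k, rle (sh s z.1) m = rle (sh t z.2) m}) := measure_biUnion_finset_le _ _
    _ ≤ ∑ s ∈ Finset.range (P+1), ∑ t ∈ Finset.range (P+1), SE μ k :=
        Finset.sum_le_sum fun s _ => (measure_biUnion_finset_le _ _).trans
          (Finset.sum_le_sum fun t _ => h1 s t)
    _ = _ := by
        simp only [Finset.sum_const, Finset.card_range, nsmul_eq_mul]
        ring

noncomputable def words (A : Type*) [Fintype A] (k G : ℕ) : Finset (Fin k → A × ℕ) :=
  (wlen_finite k G).toFinset

lemma trunc_bound (μ : Measure (ℕ → A)) [IsProbabilityMeasure μ]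
    (hinv : MeasurePreserving (shift (A := A)) μ μ)
    (c h : ℝ) (hA : HypA μ c h) (k l : ℕ) (hl : 0 < l) :
    pushCylSum μ k ≤ ∑ ω ∈ words A k (k * l), μ.real (Cyl ω) ^ 2 +
      ((k * l : ℕ) * (Fintype.card A * (c * Real.exp (-h * l)))) := by
  classical
  set C' : (Fin k → A × ℕ) → Set (ℕ → A) := fun ω => if wlen ω ≤ k * l then ∅ else Cyl ω with hC'
  have hb : ∑' ω, μ (C' ω) ≤ ENNReal.ofReal ((k * l : ℕ) * (Fintype.card A * (c * Real.exp (-h * l)))) := by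
    rw [← measure_iUnion]
    · refine (measure_mono ?_).trans (longrun_bound μ hinv c h hA (k * l) l)
      intro x hx
      obtain ⟨ω, hω⟩ := Set.mem_iUnion.1 hx
      simp only [hC'] at hω
      split_ifs at hω with h1
      · exact absurd hω (Set.notMem_empty x)
      · by_contra hno
        apply h1
        rw [← runStart_of_cyl hω]
        apply runStart_le x k l hl _ k le_rfl
        intro i hi
        by_contra hno2
        apply hno
        refine ⟨i, hi, fun t ht => ?_⟩
        by_contra hne
        exact hno2 ⟨t, ht, hne⟩
    · intro ω ω' hne
      simp only [hC', Function.onFun]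
      split_ifs
      · simp
      · simp
      · simp
      · exact cyl_disjoint hne
    · intro ω
      simp only [hC']
      split_ifs
      · exact MeasurableSet.empty
      · exact cyl_meas ω
  have hSE : SE μ k ≤ ∑ ω ∈ words A k (k * l), μ (Cyl ω) ^ 2 + ∑' ω, μ (C' ω) := by
    calc SE μ k ≤ ∑' ω : Fin k → A × ℕ,
          ((if ω ∈ words A k (k*l) then μ (Cyl ω) ^ 2 else 0) + μ (C' ω)) := by
          apply ENNReal.tsum_le_tsum
          intro ω
          by_cases hω : wlen ω ≤ k * l
          · have : ω ∈ words A k (k*l) := by simpa [words] using hω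
            rw [if_pos this]
            exact le_self_add
          · have : ω ∉ words A k (k*l) := by simpa [words] using hω
            rw [if_neg this, zero_add]
            simp only [hC', if_neg hω]
            rw [sq]
            exact mul_le_of_le_one_left' prob_le_one
      _ = ∑' ω : Fin k → A × ℕ, (if ω ∈ words A k (k*l) then μ (Cyl ω) ^ 2 else 0) +
            ∑' ω, μ (C' ω) := ENNReal.tsum_add
      _ = _ := by
          congr 1
          rw [tsum_eq_sum (s := words A k (k*l))]
          · exact Finset.sum_congr rfl fun ω hω => if_pos hω
          · intro ω hω; exact if_neg hω
  have hc := hA.1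
  have hfin : ∑ ω ∈ words A k (k * l), μ (Cyl ω) ^ 2 ≠ ∞ :=
    (ENNReal.sum_lt_top.2 fun _ _ => (ENNReal.pow_ne_top (measure_ne_top _ _)).lt_top).ne
  have h3 := ENNReal.toReal_mono (by finiteness) (hSE.trans (add_le_add_right hb _))
  rw [ENNReal.toReal_add hfin (by finiteness), ENNReal.toReal_ofReal (by positivity),
    ENNReal.toReal_sum (fun _ _ => ENNReal.pow_ne_top (measure_ne_top _ _)),
    ← push_eq μ hinv c h hA] at h3
  simpa only [ENNReal.toReal_pow, measureReal_def] using h3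

lemma lower_prob (μ : Measure (ℕ → A)) [IsProbabilityMeasure μ]
    (hinv : MeasurePreserving (shift (A := A)) μ μ)
    (a : ℝ) (ha : 0 < a) (hpsi : PsiMixingPoly μ a)
    (k G g R : ℕ) (hg : 1 ≤ g) (hR : 0 < R) (v : ℝ) (hv : 0 < v)
    (hT : ∑ ω ∈ words A k G, μ.real (Cyl ω) ^ 2 = v ^ 2) :
    (μ.prod μ).real {z | ¬ ∃ i < R * (G + g), ∃ j < R * (G + g),
        ∀ m < k, rle (sh i z.1) m = rle (sh j z.2) m} ≤
      3 * (g : ℝ) ^ (-a) + 4 / (R * v) + 1 / (R * v) ^ 2 := by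
  have hg0 : (1 : ℝ) ≤ g := by exact_mod_cast hg
  have hψ0 : 0 ≤ (g : ℝ) ^ (-a) := Real.rpow_nonneg (by linarith) _
  have hψ1 : (g : ℝ) ^ (-a) ≤ 1 := Real.rpow_le_one_of_one_le_of_nonpos hg0 (by linarith)
  have hmem : ∀ w ∈ words A k G, wlen w ≤ G := fun w hw => by simpa [words] using hw
  have hreal : ∀ (w : Fin k → A × ℕ) (b : ℕ), μ.real (sh b ⁻¹' Cyl w) = μ.real (Cyl w) := by
    intro w b
    simp only [measureReal_def]
    rw [(sh_mp μ hinv b).measure_preimage (cyl_meas w).nullMeasurableSet]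
  have hmix : ∀ w ∈ words A k G, ∀ w' ∈ words A k G, ∀ b b' : ℕ, b < b' →
      μ.real (sh (b * (G + g)) ⁻¹' Cyl w ∩ sh (b' * (G + g)) ⁻¹' Cyl w') ≤
        (1 + (g : ℝ) ^ (-a)) * (μ.real (Cyl w) * μ.real (Cyl w')) := by
    intro w hw w' hw' b b' hbb
    have h1 : b * (G + g) + (G + g) ≤ b' * (G + g) := by
      have := Nat.mul_le_mul_right (G + g) hbb
      linarith [Nat.succ_mul b (G + g)]
    obtain ⟨g', hg'⟩ : ∃ g', b' * (G + g) = b * (G + g) + G + g' := ⟨b' * (G + g) - (b * (G + g) + G), by omega⟩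
    have hgg : g ≤ g' := by omega
    have hS : MeasurableSet[cylAlgLE A (b * (G + g) + G)] (sh (b * (G + g)) ⁻¹' Cyl w) := by
      apply meas_LE
      intro x y hxy hx
      refine cyl_agree (hmem w hw) (sh (b * (G+g)) x) _ ?_ hx
      intro i hi
      exact hxy _ (by omega)
    have hT' := meas_GE (b' * (G + g)) _ (cyl_meas w')
    rw [hg'] at hT' ⊢
    have key := psi_upper μ a hpsi _ g' (by omega) _ _ hS hT'
    have hle : (g' : ℝ) ^ (-a) ≤ (g : ℝ) ^ (-a) :=
      Real.rpow_le_rpow_of_nonpos (by linarith) (by exact_mod_cast hgg) (by linarith)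
    change _ ≤ (1 + (g' : ℝ) ^ (-a)) * μ.real _ * μ.real _ at key
    rw [hreal, hreal] at key
    refine key.trans ?_
    rw [mul_assoc]
    have : 0 ≤ μ.real (Cyl w) * μ.real (Cyl w') := mul_nonneg measureReal_nonneg measureReal_nonneg
    gcongr
  have := second_moment μ (words A k G) (fun w b => sh (b * (G + g)) ⁻¹' Cyl w)
    (fun w b => sh_measurable _ (cyl_meas w)) (fun w => μ.real (Cyl w))
    (fun w _ b => hreal w _) (fun w _ w' _ hww b => (cyl_disjoint hww).preimage _)
    ((g : ℝ) ^ (-a)) hψ0 hψ1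
    (by
      intro w hw w' hw' b b' hbb
      rcases lt_or_gt_of_ne hbb with h1 | h1
      · exact hmix w hw w' hw' b b' h1
      · rw [Set.inter_comm, mul_comm (μ.real (Cyl w))]
        exact hmix w' hw' w hw b' b h1)
    R hR v hv hT
  refine le_trans (measureReal_mono ?_ (measure_ne_top _ _)) this
  intro z hz b hb b' hb' w hw hzz
  apply hz
  have hpos : 0 < G + g := by omega
  refine ⟨b * (G + g), Nat.mul_lt_mul_of_pos_right hb hpos, b' * (G + g),
    Nat.mul_lt_mul_of_pos_right hb' hpos, fun m hm => ?_⟩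
  have h1 := hzz.1.1 ⟨m, hm⟩
  have h2 := hzz.2.1 ⟨m, hm⟩
  exact h1.trans h2.symm
end prob

open MeasureTheory Filter Topology
open scoped ENNReal

section asym

lemma poly_exp (C η : ℝ) (d : ℕ) (hη : 0 < η) : ∀ᶠ k : ℕ in atTop, C * (k : ℝ) ^ d ≤ Real.exp (η * k) := by
  have h1 := (isLittleO_pow_exp_pos_mul_atTop d hη).comp_tendsto (tendsto_natCast_atTop_atTop (R := ℝ))
  have h2 := (h1.const_mul_left C).bound (show (0:ℝ) < 1 by norm_num)
  filter_upwards [h2] with k hk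
  simp only [Function.comp] at hk
  rw [one_mul, Real.norm_eq_abs, Real.norm_eq_abs, abs_of_pos (Real.exp_pos _)] at hk
  exact (le_abs_self _).trans hk

lemma sq_exp (h B : ℝ) (hh : 0 < h) : ∀ᶠ k : ℕ in atTop, Real.exp (-h * (k ^ 2 : ℕ)) ≤ Real.exp (-B * k) := by
  filter_upwards [(tendsto_natCast_atTop_atTop (R := ℝ)).eventually_ge_atTop (B / h)] with k hk
  apply Real.exp_le_exp.2
  rw [div_le_iff₀ hh] at hk
  push_cast
  nlinarith [(Nat.cast_nonneg k : (0:ℝ) ≤ k)]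

lemma borel_cantelli_exp {Ω : Type*} [MeasurableSpace Ω] (P : Measure Ω) [IsProbabilityMeasure P]
    (E : ℕ → Set Ω) (η : ℝ) (hη : 0 < η)
    (hb : ∀ᶠ k : ℕ in atTop, P (E k) ≤ ENNReal.ofReal (Real.exp (-η * k))) :
    ∀ᵐ z ∂P, ∀ᶠ k : ℕ in atTop, z ∉ E k := by
  classical
  obtain ⟨k0, hk0⟩ := eventually_atTop.1 hb
  have hsum : Summable (fun k : ℕ => Real.exp (-η * k)) := by
    have := Real.summable_exp_nat_mul_iff.2 (show -η < 0 by linarith)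
    refine this.congr fun k => ?_
    rw [mul_comm]
  have := ae_eventually_notMem (μ := P) (s := fun k => if k0 ≤ k then E k else ∅) (by
    have hle : ∑' k, P (if k0 ≤ k then E k else ∅) ≤ ∑' k : ℕ, ENNReal.ofReal (Real.exp (-η * k)) := by
      apply ENNReal.tsum_le_tsum
      intro k
      split_ifs with h
      · exact hk0 k h
      · simp
    rw [← ENNReal.ofReal_tsum_of_nonneg (fun k => (Real.exp_pos _).le) hsum] at hle
    exact (hle.trans_lt ENNReal.ofReal_lt_top).ne)
  filter_upwards [this] with z hz
  filter_upwards [hz, eventually_ge_atTop k0] with k hk hkk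
  simpa [hkk] using hk

lemma det_upper (M : ℕ → ℕ) (α b : ℝ) (hα : 0 < α) (hb : 1 / α < b)
    (hM : ∀ᶠ k : ℕ in atTop, ∀ n : ℕ, (n : ℝ) ≤ Real.exp (α * k) → M n < k) :
    ∀ᶠ n : ℕ in atTop, (M n : ℝ) / Real.log n < b := by
  have hlog : Tendsto (fun n : ℕ => Real.log n) atTop atTop :=
    Real.tendsto_log_atTop.comp tendsto_natCast_atTop_atTop
  have hk : Tendsto (fun n : ℕ => ⌈Real.log n / α⌉₊) atTop atTop :=
    tendsto_nat_ceil_atTop.comp (hlog.atTop_div_const hα)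
  filter_upwards [hk.eventually hM, hlog.eventually_gt_atTop (1 / (b - 1/α)),
    hlog.eventually_gt_atTop 0, eventually_gt_atTop 0] with n h1 h2 h3 hn
  have hn' : (0:ℝ) < n := by exact_mod_cast hn
  have h4 : (n : ℝ) ≤ Real.exp (α * ⌈Real.log n / α⌉₊) := by
    rw [← Real.log_le_iff_le_exp hn']
    have := Nat.le_ceil (Real.log n / α)
    rw [div_le_iff₀ hα] at this
    linarith
  have h5 : (M n : ℝ) < ⌈Real.log n / α⌉₊ := by exact_mod_cast h1 n h4
  have h6 := Nat.ceil_lt_add_one (show 0 ≤ Real.log n / α by positivity)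
  rw [div_lt_iff₀ h3]
  have h7 : 0 < b - 1/α := by linarith
  rw [div_lt_iff₀ h7] at h2
  have : Real.log n / α = Real.log n * (1/α) := by ring
  nlinarith

lemma det_lower (M : ℕ → ℕ) (β b : ℝ) (hβ : 0 < β) (hb : b < 1 / β)
    (hM : ∀ᶠ k : ℕ in atTop, ∀ n : ℕ, Real.exp (β * k) ≤ (n : ℝ) → k ≤ M n + 1) :
    ∀ᶠ n : ℕ in atTop, b < (M n : ℝ) / Real.log n := by
  have hlog : Tendsto (fun n : ℕ => Real.log n) atTop atTop :=
    Real.tendsto_log_atTop.comp tendsto_natCast_atTop_atTop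
  have hk : Tendsto (fun n : ℕ => ⌊Real.log n / β⌋₊) atTop atTop :=
    tendsto_nat_floor_atTop.comp (hlog.atTop_div_const hβ)
  filter_upwards [hk.eventually hM, hlog.eventually_gt_atTop (2 / (1/β - b)),
    hlog.eventually_gt_atTop 0, eventually_gt_atTop 0] with n h1 h2 h3 hn
  have hn' : (0:ℝ) < n := by exact_mod_cast hn
  have h4 : Real.exp (β * ⌊Real.log n / β⌋₊) ≤ n := by
    rw [← Real.le_log_iff_exp_le hn']
    have := Nat.floor_le (show 0 ≤ Real.log n / β by positivity)
    rw [le_div_iff₀ hβ] at this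
    linarith
  have h5 : (⌊Real.log n / β⌋₊ : ℝ) ≤ M n + 1 := by exact_mod_cast h1 n h4
  have h6 := Nat.lt_floor_add_one (Real.log n / β)
  rw [lt_div_iff₀ h3]
  have h7 : 0 < 1/β - b := by linarith
  rw [div_lt_iff₀ h7] at h2
  have : Real.log n / β = Real.log n * (1/β) := by ring
  nlinarith

lemma ev_upper (S : ℕ → ℝ) (hS : ∀ n, 0 < S n) (H δ : ℝ) (hδ : 0 < δ)
    (hlim : Tendsto (fun n : ℕ => Real.log (S n) / n) atTop (𝓝 (-H))) :
    ∀ᶠ k : ℕ in atTop, S k ≤ Real.exp (-(H - δ) * k) := by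
  filter_upwards [hlim.eventually (gt_mem_nhds (show -H < -(H - δ) by linarith)),
    eventually_gt_atTop 0] with k hk h0
  have h0' : (0:ℝ) < k := by exact_mod_cast h0
  rw [div_lt_iff₀ h0'] at hk
  rw [← Real.log_le_iff_le_exp (hS k)]
  exact hk.le

lemma ev_lower (S : ℕ → ℝ) (hS : ∀ n, 0 < S n) (H δ : ℝ) (hδ : 0 < δ)
    (hlim : Tendsto (fun n : ℕ => Real.log (S n) / n) atTop (𝓝 (-H))) :
    ∀ᶠ k : ℕ in atTop, Real.exp (-(H + δ) * k) ≤ S k := by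
  filter_upwards [hlim.eventually (lt_mem_nhds (show -(H + δ) < -H by linarith)),
    eventually_gt_atTop 0] with k hk h0
  have h0' : (0:ℝ) < k := by exact_mod_cast h0
  rw [lt_div_iff₀ h0'] at hk
  rw [← Real.le_log_iff_exp_le (hS k)]
  exact hk.le

end asym

section main
variable {A : Type*} [Fintype A] [MeasurableSpace A] [MeasurableSingletonClass A]

lemma longrun_ae (μ : Measure (ℕ → A)) [IsProbabilityMeasure μ]
    (hinv : MeasurePreserving (shift (A := A)) μ μ)
    (c h : ℝ) (hA : HypA μ c h) (α : ℝ) :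
    ∀ᵐ x ∂μ, ∀ᶠ k : ℕ in atTop, ∀ i < ⌊Real.exp (α * k)⌋₊ * k ^ 2, ∃ t < k ^ 2, x (i + t) ≠ x i := by
  have := borel_cantelli_exp μ
    (fun k => {x | ∃ i < ⌊Real.exp (α * k)⌋₊ * k ^ 2, ∀ t < k ^ 2, x (i + t) = x i}) 1 one_pos (by
      filter_upwards [poly_exp (Fintype.card A * c) 1 2 one_pos, sq_exp h (α + 2) hA.2.1] with k h1 h2
      refine (longrun_bound μ hinv c h hA _ _).trans ?_
      apply ENNReal.ofReal_le_ofReal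
      have hf := Nat.floor_le (Real.exp_pos (α * k)).le
      have hc := hA.1
      calc ((⌊Real.exp (α * k)⌋₊ * k ^ 2 : ℕ) : ℝ) * (Fintype.card A * (c * Real.exp (-h * (k ^ 2 : ℕ))))
          = (⌊Real.exp (α * k)⌋₊ : ℝ) * (Fintype.card A * c * (k:ℝ) ^ 2) * Real.exp (-h * (k ^ 2 : ℕ)) := by
            push_cast; ring
        _ ≤ Real.exp (α * k) * Real.exp (1 * k) * Real.exp (-(α + 2) * k) := by gcongr
        _ = _ := by rw [← Real.exp_add, ← Real.exp_add]; congr 1; ring)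
  filter_upwards [this] with x hx
  filter_upwards [hx] with k hk i hi
  by_contra hno
  apply hk
  refine ⟨i, hi, fun t ht => ?_⟩
  by_contra hne
  exact hno ⟨t, ht, hne⟩

lemma upper_ae (μ : Measure (ℕ → A)) [IsProbabilityMeasure μ]
    (hinv : MeasurePreserving (shift (A := A)) μ μ)
    (c h : ℝ) (hA : HypA μ c h) (H : ℝ)
    (hlim : Tendsto (fun n : ℕ => Real.log (pushCylSum μ n) / n) atTop (𝓝 (-H)))
    (hpos : ∀ n, 0 < pushCylSum μ n) (α : ℝ) (hα : 0 < α) (hαH : 2 * α < H) :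
    ∀ᵐ z ∂(μ.prod μ), ∀ᶠ k : ℕ in atTop, ∀ n : ℕ, (n : ℝ) ≤ Real.exp (α * k) → MRLE z.1 z.2 n < k := by
  have hL := longrun_ae μ hinv c h hA α
  have hL1 := Measure.quasiMeasurePreserving_fst (μ := μ) (ν := μ) |>.ae hL
  have hL2 := Measure.quasiMeasurePreserving_snd (μ := μ) (ν := μ) |>.ae hL
  set η := (H - 2 * α) / 3 with hη
  have hη0 : 0 < η := by rw [hη]; linarith
  have hM := borel_cantelli_exp (μ.prod μ)
    (fun k => {z | ∃ s ≤ ⌊Real.exp (α * k)⌋₊ * k ^ 2, ∃ t ≤ ⌊Real.exp (α * k)⌋₊ * k ^ 2,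
      ∀ m < k, rle (sh s z.1) m = rle (sh t z.2) m}) η hη0 (by
      filter_upwards [poly_exp 4 η 4 hη0, ev_upper _ hpos H η hη0 hlim, eventually_gt_atTop 0] with k h1 h2 h0
      refine (match_bound μ hinv c h hA _ _).trans ?_
      have hfin : SE μ k ≠ ∞ := ((SE_le_one μ hinv c h hA k).trans_lt ENNReal.one_lt_top).ne
      rw [← ENNReal.ofReal_toReal hfin, ← push_eq μ hinv c h hA, ← ENNReal.ofReal_natCast,
        ← ENNReal.ofReal_pow (by positivity), ← ENNReal.ofReal_mul (by positivity)]
      apply ENNReal.ofReal_le_ofReal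
      have hf := Nat.floor_le (Real.exp_pos (α * k)).le
      have h0' : (1:ℝ) ≤ k := by exact_mod_cast h0
      have he : 1 ≤ Real.exp (α * k) := Real.one_le_exp (by positivity)
      have h3 : ((⌊Real.exp (α * k)⌋₊ * k ^ 2 + 1 : ℕ) : ℝ) ≤ 2 * (k:ℝ) ^ 2 * Real.exp (α * k) := by
        push_cast
        have h4 : (1:ℝ) ≤ (k:ℝ) ^ 2 := one_le_pow₀ h0'
        have h5 : 1 ≤ (k:ℝ) ^ 2 * Real.exp (α * k) := one_le_mul_of_one_le_of_one_le h4 he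
        nlinarith [mul_le_mul_of_nonneg_right hf (by positivity : 0 ≤ (k:ℝ)^2)]
      calc ((⌊Real.exp (α * k)⌋₊ * k ^ 2 + 1 : ℕ) : ℝ) ^ 2 * pushCylSum μ k
          ≤ (2 * (k:ℝ) ^ 2 * Real.exp (α * k)) ^ 2 * Real.exp (-(H - η) * k) := by
            exact mul_le_mul (pow_le_pow_left₀ (by positivity) h3 2) h2 (tsum_nonneg fun _ => by positivity) (by positivity)
        _ = 4 * (k:ℝ) ^ 4 * (Real.exp (α * k) * Real.exp (α * k) * Real.exp (-(H - η) * k)) := by ring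
        _ ≤ Real.exp (η * k) * (Real.exp (α * k) * Real.exp (α * k) * Real.exp (-(H - η) * k)) := by
            gcongr
        _ = _ := by
            rw [← Real.exp_add, ← Real.exp_add, ← Real.exp_add]
            congr 1
            rw [hη]; ring)
  filter_upwards [hL1, hL2, hM] with z h1 h2 h3
  filter_upwards [h1, h2, h3, eventually_gt_atTop 0] with k h1 h2 h3 h0 n hn
  exact MRLE_lt z.1 z.2 k ⌊Real.exp (α * k)⌋₊ (k^2) h0 (by positivity) h1 h2 h3 n (Nat.le_floor hn)

lemma lower_ae (μ : Measure (ℕ → A)) [IsProbabilityMeasure μ]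
    (hinv : MeasurePreserving (shift (A := A)) μ μ)
    (c h : ℝ) (hA : HypA μ c h) (a : ℝ) (ha : 0 < a) (hpsi : PsiMixingPoly μ a) (H : ℝ) (hH : 0 < H)
    (hlim : Tendsto (fun n : ℕ => Real.log (pushCylSum μ n) / n) atTop (𝓝 (-H)))
    (hpos : ∀ n, 0 < pushCylSum μ n) (β : ℝ) (hβH : H < 2 * β) :
    ∀ᵐ z ∂(μ.prod μ), ∀ᶠ k : ℕ in atTop, ∀ n : ℕ, Real.exp (β * k) ≤ (n : ℝ) → k ≤ MRLE z.1 z.2 n + 1 := by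
  have hN := ae_nc μ hinv c h hA
  have hN1 := Measure.quasiMeasurePreserving_fst (μ := μ) (ν := μ) |>.ae hN
  have hN2 := Measure.quasiMeasurePreserving_snd (μ := μ) (ν := μ) |>.ae hN
  obtain ⟨η, hη0, hη⟩ : ∃ η, 0 < η ∧ β = H / 2 + 3 * η := ⟨(β - H/2)/3, by linarith, by ring⟩
  obtain ⟨θ, hθ0, hθ1, hθ2⟩ : ∃ θ, 0 < θ ∧ 2 * θ ≤ a * η ∧ 2 * θ ≤ η / 2 :=
    ⟨min (a * η) (η / 2) / 2, by positivity, by linarith [min_le_left (a * η) (η / 2)],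
      by linarith [min_le_right (a * η) (η / 2)]⟩
  set g : ℕ → ℕ := fun k => ⌈Real.exp (η * k)⌉₊ with hg
  set R : ℕ → ℕ := fun k => ⌈Real.exp ((H / 2 + η) * k)⌉₊ with hR
  have hM := borel_cantelli_exp (μ.prod μ)
    (fun k => {z | ¬ ∃ i < R k * (k * k ^ 2 + g k), ∃ j < R k * (k * k ^ 2 + g k),
        ∀ m < k, rle (sh i z.1) m = rle (sh j z.2) m}) θ hθ0 (by
      filter_upwards [poly_exp 15 θ 0 hθ0, ev_lower _ hpos H η hη0 hlim,
        poly_exp (2 * (Fintype.card A * c)) 1 3 one_pos, sq_exp h (H + η + 1) hA.2.1,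
        eventually_gt_atTop 0] with k h1 h2 h3 h4 h0
      have hc := hA.1
      have ht := trunc_bound μ hinv c h hA k (k^2) (by positivity)
      have htail : ((k * k ^ 2 : ℕ) : ℝ) * (Fintype.card A * (c * Real.exp (-h * (k ^ 2 : ℕ)))) ≤
          Real.exp (-(H + η) * k) / 2 := by
        calc ((k * k ^ 2 : ℕ) : ℝ) * (Fintype.card A * (c * Real.exp (-h * (k ^ 2 : ℕ))))
            = (2 * (Fintype.card A * c) * (k:ℝ) ^ 3) * Real.exp (-h * (k ^ 2 : ℕ)) / 2 := by
              push_cast; ring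
          _ ≤ Real.exp (1 * k) * Real.exp (-(H + η + 1) * k) / 2 := by gcongr
          _ = _ := by rw [← Real.exp_add]; congr 2; ring
      set T := ∑ ω ∈ words A k (k * k ^ 2), μ.real (Cyl ω) ^ 2 with hT
      have hT1 : Real.exp (-(H + η) * k) / 4 ≤ T := by
        have := Real.exp_pos (-(H + η) * k)
        linarith
      have hv1 : Real.exp (-(H/2 + η/2) * k) / 2 ≤ √T := by
        apply Real.le_sqrt_of_sq_le
        refine le_trans (le_of_eq ?_) hT1
        rw [div_pow, sq (Real.exp _), ← Real.exp_add]
        norm_num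
        ring
      have hT0 : 0 ≤ T := le_trans (by positivity) hT1
      have hv0 : 0 < √T := lt_of_lt_of_le (by positivity) hv1
      have hg1 : Real.exp (η * k) ≤ g k := Nat.le_ceil _
      have hR1 : Real.exp ((H / 2 + η) * k) ≤ R k := Nat.le_ceil _
      have hgpos : 0 < g k := Nat.ceil_pos.2 (Real.exp_pos _)
      have hRpos : 0 < R k := Nat.ceil_pos.2 (Real.exp_pos _)
      have key := lower_prob μ hinv a ha hpsi k (k * k^2) (g k) (R k) hgpos hRpos (√T) hv0
        (Real.sq_sqrt hT0).symm
      rw [← ENNReal.ofReal_toReal (measure_ne_top (μ.prod μ) _)]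
      apply ENNReal.ofReal_le_ofReal
      refine key.trans ?_
      have hRv : Real.exp (η / 2 * k) / 2 ≤ R k * √T := by
        calc Real.exp (η / 2 * k) / 2 = Real.exp ((H / 2 + η) * k) * (Real.exp (-(H/2 + η/2) * k) / 2) := by
              rw [← mul_div_assoc, ← Real.exp_add]; congr 2; ring
          _ ≤ _ := by gcongr
      have hk0 : (0:ℝ) ≤ k := Nat.cast_nonneg k
      have hb1 : (g k : ℝ) ^ (-a) ≤ Real.exp (-(2 * θ) * k) := by
        calc (g k : ℝ) ^ (-a) ≤ (Real.exp (η * k)) ^ (-a) :=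
              Real.rpow_le_rpow_of_nonpos (Real.exp_pos _) hg1 (by linarith)
          _ = Real.exp (η * k * (-a)) := by rw [← Real.exp_mul]
          _ ≤ _ := by
              apply Real.exp_le_exp.2
              nlinarith
      have hb2 : 1 / (R k * √T) ≤ 2 * Real.exp (-(2 * θ) * k) := by
        calc 1 / (R k * √T) ≤ 1 / (Real.exp (η / 2 * k) / 2) :=
              one_div_le_one_div_of_le (by positivity) hRv
          _ = 2 * Real.exp (-(η / 2 * k)) := by rw [Real.exp_neg]; field_simp
          _ ≤ _ := by
              gcongr
              nlinarith
      have he1 : Real.exp (-(2 * θ) * k) ≤ 1 := Real.exp_le_one_iff.2 (by nlinarith)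
      have he0 := Real.exp_pos (-(2 * θ) * k)
      have hb3 : 1 / (R k * √T) ^ 2 ≤ 4 * Real.exp (-(2 * θ) * k) := by
        have h5 : 0 ≤ 1 / (R k * √T) := by positivity
        calc 1 / (R k * √T) ^ 2 = (1 / (R k * √T)) ^ 2 := by rw [div_pow, one_pow]
          _ ≤ (2 * Real.exp (-(2 * θ) * k)) ^ 2 := pow_le_pow_left₀ h5 hb2 2
          _ ≤ _ := by nlinarith
      have h6 : 4 / (R k * √T) = 4 * (1 / (R k * √T)) := by ring
      rw [h6]
      calc _ ≤ 15 * Real.exp (-(2 * θ) * k) := by linarith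
        _ ≤ Real.exp (θ * k) * Real.exp (-(2 * θ) * k) := by
            gcongr
            simpa using h1
        _ = _ := by rw [← Real.exp_add]; congr 1; ring)
  filter_upwards [hN1, hN2, hM] with z h1 h2 h3
  filter_upwards [h3, poly_exp 1 η 3 hη0, poly_exp 1 η 1 hη0, poly_exp 7 η 0 hη0] with k h3 h4 h5 h6 n hn
  simp only [Set.mem_ofPred_eq, not_not] at h3
  obtain ⟨i, hi, j, hj, hm⟩ := h3
  have hk0 : (0:ℝ) ≤ k := Nat.cast_nonneg k
  have hsize : R k * (k * k ^ 2 + g k) + k ≤ n := by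
    have hg1 : (g k : ℝ) ≤ 2 * Real.exp (η * k) := by
      have := Nat.ceil_lt_add_one (Real.exp_pos (η * k)).le
      have := Real.one_le_exp (show 0 ≤ η * k by positivity)
      linarith
    have hR1 : (R k : ℝ) ≤ 2 * Real.exp ((H / 2 + η) * k) := by
      have := Nat.ceil_lt_add_one (Real.exp_pos ((H / 2 + η) * k)).le
      have := Real.one_le_exp (show 0 ≤ (H / 2 + η) * k by positivity)
      linarith
    have : ((R k * (k * k ^ 2 + g k) + k : ℕ) : ℝ) ≤ n := by
      refine le_trans ?_ hn
      push_cast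
      have h7 : (k:ℝ) * k ^ 2 = 1 * (k:ℝ) ^ 3 := by ring
      rw [h7]
      have h8 : (k:ℝ) ≤ Real.exp (η * k) := by simpa using h5
      have h9 : (7:ℝ) ≤ Real.exp (η * k) := by simpa using h6
      have h10 := Real.one_le_exp (show 0 ≤ (H / 2 + η) * k by positivity)
      have h11 := Real.exp_pos (η * k)
      calc (R k : ℝ) * (1 * (k:ℝ) ^ 3 + g k) + k
          ≤ (2 * Real.exp ((H / 2 + η) * k)) * (Real.exp (η * k) + 2 * Real.exp (η * k)) + Real.exp (η * k) := by
            gcongr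
        _ ≤ 7 * (Real.exp ((H / 2 + η) * k) * Real.exp (η * k)) := by nlinarith
        _ ≤ Real.exp (η * k) * (Real.exp ((H / 2 + η) * k) * Real.exp (η * k)) := by gcongr
        _ = _ := by
            rw [← Real.exp_add, ← Real.exp_add, hη]; congr 1; ring
    exact_mod_cast this
  exact MRLE_ge z.1 z.2 h1 h2 k i j n (by omega) (by omega) hm

end main

theorem stmt3 {A : Type*} [Fintype A] [MeasurableSpace A] [MeasurableSingletonClass A]
    (μ : Measure (ℕ → A)) [IsProbabilityMeasure μ]
    (hinv : MeasurePreserving (shift (A := A)) μ μ)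
    (c h : ℝ) (hA : HypA μ c h)
    (hmix : ∃ a : ℝ, 0 < a ∧ PsiMixingPoly μ a)
    (hH : 0 < H2lower μ) :
    (∀ᵐ p ∂(μ.prod μ),
      2 / H2upper μ ≤ liminf (fun n : ℕ => (MRLE p.1 p.2 n : ℝ) / Real.log n) atTop) ∧
    (H2lower μ = H2upper μ →
      ∀ᵐ p ∂(μ.prod μ),
        Tendsto (fun n : ℕ => (MRLE p.1 p.2 n : ℝ) / Real.log n) atTop
          (𝓝 (2 / H2lower μ))) := by
  obtain ⟨a, ha, hpsi⟩ := hmix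
  obtain ⟨H, hH0, hl, hu, hlim⟩ := entropy_exists μ hinv c h hA a ha hpsi hH
  have hpos : ∀ n, 0 < pushCylSum μ n := by
    intro n
    rw [push_eq μ hinv c h hA]
    exact ENNReal.toReal_pos (SE_ne_zero μ hinv c h hA n)
      ((SE_le_one μ hinv c h hA n).trans_lt ENNReal.one_lt_top).ne
  have hup : ∀ q : ℚ, ∀ᵐ p ∂(μ.prod μ), 2 / H < q →
      ∀ᶠ n : ℕ in atTop, (MRLE p.1 p.2 n : ℝ) / Real.log n < q := by
    intro q
    by_cases hq : 2 / H < q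
    · obtain ⟨r, hr1, hr2⟩ := exists_between hq
      have hr0 : 0 < r := lt_trans (by positivity) hr1
      have := upper_ae μ hinv c h hA H hlim hpos (1 / r) (by positivity) (by
        rw [div_lt_iff₀ hH0] at hr1
        rw [mul_one_div, div_lt_iff₀ hr0]; linarith)
      filter_upwards [this] with p hp _
      exact det_upper _ (1 / r) q (by positivity) (by rw [one_div_one_div]; exact hr2) hp
    · exact Eventually.of_forall fun p h => absurd h hq
  have hlo : ∀ q : ℚ, ∀ᵐ p ∂(μ.prod μ), (q : ℝ) < 2 / H →
      ∀ᶠ n : ℕ in atTop, (q : ℝ) < (MRLE p.1 p.2 n : ℝ) / Real.log n := by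
    intro q
    by_cases hq : (q : ℝ) < 2 / H
    · obtain ⟨r, hr1, hr2⟩ := exists_between (max_lt hq (show 0 < 2 / H by positivity))
      have hr0 : 0 < r := lt_of_le_of_lt (le_max_right _ _) hr1
      have hrq : (q : ℝ) < r := lt_of_le_of_lt (le_max_left _ _) hr1
      have := lower_ae μ hinv c h hA a ha hpsi H hH0 hlim hpos (1 / r) (by
        rw [lt_div_iff₀ hH0] at hr2
        rw [mul_one_div, lt_div_iff₀ hr0]; linarith)
      filter_upwards [this] with p hp _
      exact det_lower _ (1 / r) q (by positivity) (by rw [one_div_one_div]; exact hrq) hp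
    · exact Eventually.of_forall fun p h => absurd h hq
  have main : ∀ᵐ p ∂(μ.prod μ),
      Tendsto (fun n : ℕ => (MRLE p.1 p.2 n : ℝ) / Real.log n) atTop (𝓝 (2 / H)) := by
    filter_upwards [ae_all_iff.2 hup, ae_all_iff.2 hlo] with p h1 h2
    rw [tendsto_order]
    constructor
    · intro b hb
      obtain ⟨q, hq1, hq2⟩ := exists_rat_btwn hb
      filter_upwards [h2 q hq2] with n hn
      linarith
    · intro b hb
      obtain ⟨q, hq1, hq2⟩ := exists_rat_btwn hb
      filter_upwards [h1 q hq1] with n hn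
      linarith
  refine ⟨?_, fun _ => ?_⟩
  · filter_upwards [main] with p hp
    rw [hp.liminf_eq, hu]
  · rw [hl]; exact main
end

section
/- Let x, y ∈ A^ℕ and n ∈ ℕ. If |f(x_1^n)| ≥ u(n) and |f(y_1^n)| ≥ u(n) for some u(n) ∈ ℕ (where |f(x_1^n)| denotes the number of symbols of the run-length encoding of the first n symbols of x), then M^RLE_{u(n)}(x,y) ≤ M̃_n(x,y). -/
open MeasureTheory Filter Topology

theorem nextChange_shift {A : Type*} (x : ℕ → A) (I q : ℕ) :
    nextChange (fun t => x (t + I)) q + I = nextChange x (q + I) := by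
  classical
  have e : ∀ j, q + j + 1 + I = q + I + j + 1 := fun j => by omega
  unfold nextChange
  simp only [e]
  split_ifs <;> omega

theorem runStart_shift {A : Type*} (x : ℕ → A) (i m : ℕ) :
    runStart (fun t => x (t + runStart x i)) m + runStart x i = runStart x (i + m) := by
  induction m with
  | zero => simp [runStart]
  | succ m ih =>
    rw [← add_assoc]
    simp only [runStart]
    rw [nextChange_shift, ih]

theorem rle_shift {A : Type*} (x : ℕ → A) (i m : ℕ) :
    rle (fun t => x (t + runStart x i)) m = rle x (i + m) := by
  have h1 := runStart_shift x i m
  have h2 := runStart_shift x i (m + 1)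
  unfold rle
  simp only [h1]
  rw [add_assoc i m 1, ← h1, ← h2]
  congr 1
  omega

theorem lt_nextChange {A : Type*} (x : ℕ → A) (p : ℕ) : p < nextChange x p := by
  unfold nextChange
  split_ifs <;> omega

theorem eq_of_lt_nextChange {A : Type*} (x : ℕ → A) (p t : ℕ) (h1 : p ≤ t)
    (h2 : t < nextChange x p) : x t = x p := by
  classical
  rcases h1.eq_or_lt with rfl | h1
  · rfl
  unfold nextChange at h2
  split_ifs at h2 with h
  · have := Nat.find_min h (m := t - p - 1) (by omega)
    rw [not_not] at this
    rwa [show p + (t - p - 1) + 1 = t by omega] at this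
  · omega

theorem runStart_add {A : Type*} (x : ℕ → A) (i k : ℕ) :
    runStart x i + k ≤ runStart x (i + k) := by
  induction k with
  | zero => simp
  | succ k ih =>
    have := lt_nextChange x (runStart x (i + k))
    rw [← add_assoc i k 1]
    simp only [runStart]
    omega

theorem runCount_runStart {A : Type*} (x : ℕ → A) (r : ℕ) :
    runCount x (runStart x r) ≤ r := by
  classical
  induction r with
  | zero => simp [runStart, runCount]
  | succ r ih =>
    unfold runCount at ih ⊢
    refine le_trans (Finset.card_le_card (t := insert (runStart x r)
      ((Finset.range (runStart x r)).filter fun i => i = 0 ∨ x i ≠ x (i - 1))) ?_)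
      ((Finset.card_insert_le _ _).trans (by simpa using ih))
    intro t ht
    simp only [Finset.mem_filter, Finset.mem_range, Finset.mem_insert, runStart] at ht ⊢
    obtain ⟨h1, h2⟩ := ht
    rcases lt_trichotomy t (runStart x r) with h | h | h
    · exact Or.inr ⟨h, h2⟩
    · exact Or.inl h
    · exfalso
      rcases h2 with h2 | h2
      · omega
      · exact h2 ((eq_of_lt_nextChange x _ t h.le h1).trans
          (eq_of_lt_nextChange x _ (t - 1) (by omega) (by omega)).symm)

theorem runStart_lt {A : Type*} (x : ℕ → A) (r n : ℕ) (h : r < runCount x n) :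
    runStart x r < n := by
  classical
  by_contra! hn
  have h1 := runCount_runStart x r
  have h2 : runCount x n ≤ runCount x (runStart x r) := by
    unfold runCount
    exact Finset.card_le_card (Finset.filter_subset_filter _ (Finset.range_subset_range.2 hn))
  omega

theorem runStart_bound {A : Type*} (x : ℕ → A) (i k n : ℕ) (hk : 0 < k)
    (h : i + k ≤ runCount x n) : runStart x i + k ≤ n := by
  have h1 := runStart_add x i (k - 1)
  have h2 := runStart_lt x (i + (k - 1)) n (by omega)
  omega

/-- if `|f(x_1^n)| ≥ u` and `|f(y_1^n)| ≥ u`, then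
`M^RLE_u(x,y) ≤ M̃_n(x,y)`. -/
theorem stmt5 {A : Type*} (x y : ℕ → A) (n u : ℕ)
    (hx : u ≤ runCount x n) (hy : u ≤ runCount y n) :
    MRLE x y u ≤ Mtilde x y n := by
  unfold MRLE matchLen Mtilde
  refine csSup_le_csSup ⟨n, ?_⟩ ⟨0, 0, 0, by simp⟩ ?_
  · rintro k ⟨i, j, h, -⟩
    omega
  · rintro k ⟨i, j, hi, hj, h⟩
    rcases Nat.eq_zero_or_pos k with rfl | hk
    · exact ⟨0, 0, by simp⟩
    · refine ⟨runStart x i, runStart y j, runStart_bound x i k n hk (hi.trans hx),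
        runStart_bound y j k n hk (hj.trans hy), fun m hm => ?_⟩
      rw [rle_shift, rle_shift]
      exact h m hm
end
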